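/- Let G be a simple graph that is 3-regular and 3-connected. Then any five points of |G| lie on a subspace of |G| homeomorphic to a circle or to a θ-curve. -/

import Mathlib

open Topology

noncomputable section

variable {V : Type*}

open Classical in
/-- The Dirac function marking a vertex: the point of `|G|` corresponding to vertex `v`. -/
noncomputable def vertexPoint (v : V) : V → ℝ := fun u => if u = v then 1 else 0

open Classical in
/-- The point of `|G|` lying on the edge `vw` at parameter `t` (measured from `v` towards `w`). -/
noncomputable def edgePoint (v w : V) (t : ℝ) : V → ℝ :=
  fun u => (if u = v then 1 - t else 0) + (if u = w then t else 0)

/-- The geometric realization `|G|` of a simple graph `G`, realized as the set of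
formal convex combinations of adjacent pairs of vertices; each closed edge carries
its usual topology as a copy of `[0,1]`. -/
def GraphRealization (G : SimpleGraph V) : Set (V → ℝ) :=
  {x | (∃ v, x = vertexPoint v) ∨
    ∃ v w t, G.Adj v w ∧ t ∈ Set.Icc (0 : ℝ) 1 ∧ x = edgePoint v w t}

/-- A subset of a topological space is an arc if it is homeomorphic to `[0,1]`. -/
def IsArc {X : Type*} [TopologicalSpace X] (A : Set X) : Prop :=
  Nonempty (↥A ≃ₜ ↥unitInterval)

/-- A space is `n`-arc connected if any at most `n` points lie on a common arc. -/
def NArcConn (X : Type*) [TopologicalSpace X] (n : ℕ) : Prop :=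
  ∀ S : Finset X, S.card ≤ n → ∃ A : Set X, IsArc A ∧ ↑S ⊆ A

/-- The unit circle in the plane. -/
def unitCircleSet : Set (ℝ × ℝ) := {p | p.1 ^ 2 + p.2 ^ 2 = 1}

/-- A subset of a topological space is a simple closed curve if homeomorphic to the circle. -/
def IsSimpleClosedCurve {X : Type*} [TopologicalSpace X] (C : Set X) : Prop :=
  Nonempty (↥C ≃ₜ ↥unitCircleSet)

/-- A space is `n`-circle connected if any at most `n` points lie on a common
simple closed curve. -/
def NCircleConn (X : Type*) [TopologicalSpace X] (n : ℕ) : Prop :=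
  ∀ S : Finset X, S.card ≤ n → ∃ C : Set X, IsSimpleClosedCurve C ∧ ↑S ⊆ C

/-- A space is `n`-strongly arc connected if any list of at most `n` points is contained
in an arc, the points appearing along the arc in the listed order. -/
def NStrongArcConn (X : Type*) [TopologicalSpace X] (n : ℕ) : Prop :=
  ∀ l : List X, l.length ≤ n →
    ∃ f : ↥unitInterval → X, Topology.IsEmbedding f ∧
      ∃ t : Fin l.length → ↥unitInterval, Monotone t ∧ ∀ i, f (t i) = l.get i

/-- A graph is `k`-connected if removing fewer than `k` vertices leaves it connected. -/
def KConnected (G : SimpleGraph V) (k : ℕ) : Prop :=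
  ∀ S : Set V, S.encard < (k : ℕ∞) → (G.induce (Sᶜ : Set V)).Connected

/-- A graph is cyclically connected if any two vertices lie on a common cycle. -/
def CyclicallyConnected (G : SimpleGraph V) : Prop :=
  ∀ v w : V, ∃ (u : V) (c : G.Walk u u), c.IsCycle ∧ v ∈ c.support ∧ w ∈ c.support

/-- The circle of radius `r` centered at `c` in the plane. -/
def circleAt (c : ℝ × ℝ) (r : ℝ) : Set (ℝ × ℝ) :=
  {p | (p.1 - c.1) ^ 2 + (p.2 - c.2) ^ 2 = r ^ 2}

/-- The horizontal segment at height `y` from abscissa `a` to `b`. -/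
def hSeg (y a b : ℝ) : Set (ℝ × ℝ) := {p | p.2 = y ∧ a ≤ p.1 ∧ p.1 ≤ b}

/-- The θ-curve: unit circle together with horizontal diameter. -/
def thetaSet : Set (ℝ × ℝ) := circleAt (0, 0) 1 ∪ hSeg 0 (-1) 1

/-- Figure-eight: two unit circles meeting at the origin. -/
def figureEightSet : Set (ℝ × ℝ) := circleAt (-1, 0) 1 ∪ circleAt (1, 0) 1

/-- Lollipop: unit circle with the segment from `(1,0)` to `(2,0)` attached. -/
def lollipopSet : Set (ℝ × ℝ) := circleAt (0, 0) 1 ∪ hSeg 0 1 2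

/-- Lollipop with its free endpoint removed. -/
def openLollipopSet : Set (ℝ × ℝ) := lollipopSet \ {(2, 0)}

/-- Dumbbell: two disjoint unit circles joined by a segment. -/
def dumbbellSet : Set (ℝ × ℝ) := circleAt (-2, 0) 1 ∪ circleAt (2, 0) 1 ∪ hSeg 0 (-1) 1

/-- Happy-face curve: two circles meeting at a point, joined by a further arc. -/
def happyFaceSet : Set (ℝ × ℝ) :=
  circleAt (-1, 0) 1 ∪ circleAt (1, 0) 1 ∪ {p | p.1 ^ 2 + p.2 ^ 2 = 4 ∧ p.2 ≤ 0}

/-- Baguette curve: two disjoint circles joined by two disjoint arcs. -/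
def baguetteSet : Set (ℝ × ℝ) :=
  circleAt (-3, 0) 1 ∪ circleAt (3, 0) 1 ∪ hSeg 0 (-2) 2 ∪ hSeg 1 (-3) 3

/-- A graph is a basic 4-ac graph iff its realization is homeomorphic to a circle,
a θ-curve, a happy-face curve or a baguette curve (this captures precisely the
subdivisions of those four graphs). -/
def IsBasicFourAC {W : Type*} (H : SimpleGraph W) : Prop :=
  Nonempty (↥(GraphRealization H) ≃ₜ ↥unitCircleSet) ∨
  Nonempty (↥(GraphRealization H) ≃ₜ ↥thetaSet) ∨
  Nonempty (↥(GraphRealization H) ≃ₜ ↥happyFaceSet) ∨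
  Nonempty (↥(GraphRealization H) ≃ₜ ↥baguetteSet)

/-- A chain-graph decomposition of the connected graph `G`: links indexed by an
interval `J` of `ℤ`, non-consecutive links are disjoint, consecutive links share
exactly one vertex. -/
structure IsChainGraph (G : SimpleGraph V) (J : Set ℤ) (L : ℤ → G.Subgraph) : Prop where
  connected : G.Connected
  ordConnected : J.OrdConnected
  nonempty : J.Nonempty
  cover : (⨆ i ∈ J, L i) = (⊤ : G.Subgraph)
  sep : ∀ i ∈ J, ∀ j ∈ J, i + 1 < j → (L i).verts ∩ (L j).verts = ∅
  link : ∀ i ∈ J, i + 1 ∈ J → ∃ v, (L i).verts ∩ (L (i + 1)).verts = {v}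

/-- A cut-vertex: a vertex whose removal disconnects the graph. -/
def IsCutVertex (G : SimpleGraph V) (v : V) : Prop :=
  ¬ (G.induce ({v}ᶜ : Set V)).Connected

/-- A block: a maximal 2-connected subgraph. -/
def IsBlock (G : SimpleGraph V) (H : G.Subgraph) : Prop :=
  KConnected H.coe 2 ∧ ∀ H' : G.Subgraph, H ≤ H' → KConnected H'.coe 2 → H' = H

/-- The block graph of `G`: the bipartite graph on cut-vertices and blocks, a cut-vertex
being adjacent to the blocks containing it. -/
def BlockGraph (G : SimpleGraph V) :
    SimpleGraph ({v : V // IsCutVertex G v} ⊕ {H : G.Subgraph // IsBlock G H}) :=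
  SimpleGraph.fromRel fun a b =>
    ∃ (c : {v : V // IsCutVertex G v}) (B : {H : G.Subgraph // IsBlock G H}),
      a = Sum.inl c ∧ b = Sum.inr B ∧ (c : V) ∈ (B : G.Subgraph).verts

/-- An `A`–`B` path: a path starting in `A`, ending in `B` and meeting `A ∪ B` only
in these two endvertices. -/
structure ABPath (G : SimpleGraph V) (A B : Set V) where
  first : V
  last : V
  walk : G.Walk first last
  isPath : walk.IsPath
  firstA : first ∈ A
  lastB : last ∈ B
  meetA : ∀ v ∈ walk.support, v ∈ A → v = first
  meetB : ∀ v ∈ walk.support, v ∈ B → v = last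

/-- A family of pairwise vertex-disjoint paths. -/
def PathFamilyDisjoint {G : SimpleGraph V} {A B : Set V} {k : ℕ}
    (P : Fin k → ABPath G A B) : Prop :=
  ∀ i j, i ≠ j → ∀ v, v ∈ (P i).walk.support → v ∉ (P j).walk.support

/-- The set of vertices used by a family of paths. -/
def familySupport {G : SimpleGraph V} {A B : Set V} {k : ℕ}
    (P : Fin k → ABPath G A B) : Set V :=
  {v | ∃ i, v ∈ (P i).walk.support}

/-- The set of edges used by a family of paths. -/
def familyEdges {G : SimpleGraph V} {A B : Set V} {k : ℕ}
    (P : Fin k → ABPath G A B) : Set (Sym2 V) :=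
  {e | ∃ i, e ∈ (P i).walk.edges}

/-- A walk `W` (with no repeated edges) is alternating with respect to the disjoint
path family `P`: it starts in `A` off the paths; repeated vertices lie on paths of the
family; upon hitting a path by a new edge it follows that path backwards for at least
one edge; and it traverses edges of paths of the family only backwards. -/
structure IsAlternatingWalk {G : SimpleGraph V} {A B : Set V} {k : ℕ}
    (P : Fin k → ABPath G A B) {x y : V} (W : G.Walk x y) : Prop where
  trail : W.IsTrail
  startA : x ∈ A
  startOff : x ∉ familySupport P
  repeats : ∀ v, List.Duplicate v W.support → v ∈ familySupport P
  follows : ∀ (i : ℕ) (hi : i < W.darts.length) (j : Fin k),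
      (W.darts.get ⟨i, hi⟩).snd ∈ (P j).walk.support →
      (W.darts.get ⟨i, hi⟩).edge ∉ (P j).walk.edges →
      ∃ h : i + 1 < W.darts.length, (W.darts.get ⟨i + 1, h⟩).symm ∈ (P j).walk.darts
  backward : ∀ d ∈ W.darts, ∀ j : Fin k,
      d.edge ∈ (P j).walk.edges → d.symm ∈ (P j).walk.darts

end

namespace CubicGraph

variable {V : Type*}

/-- `Arc G u l v`: the vertices `u`, then those of `l`, then `v`, are consecutively adjacent. -/
def Arc (G : SimpleGraph V) (u : V) (l : List V) (v : V) : Prop :=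
  List.IsChain G.Adj (u :: (l ++ [v]))

/-- The edges joining consecutive entries of a list of vertices. -/
def listEdges : List V → Set (Sym2 V)
  | x :: y :: l => insert s(x, y) (listEdges (y :: l))
  | _ => ∅

/-- The edges of the arc from `u` to `v` with interior vertices `l`. -/
def arcEdges (u : V) (l : List V) (v : V) : Set (Sym2 V) := listEdges (u :: (l ++ [v]))

theorem listEdges_split (l₁ : List V) (r : V) (l₂ : List V) :
    listEdges (l₁ ++ r :: l₂) = listEdges (l₁ ++ [r]) ∪ listEdges (r :: l₂) := by
  induction l₁ with
  | nil => simp [listEdges]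
  | cons x l ih =>
    cases l with
    | nil => simp [listEdges]
    | cons y l => simp only [List.cons_append, listEdges] at ih ⊢; rw [ih, Set.insert_union]

theorem listEdges_reverse (l : List V) : listEdges l.reverse = listEdges l := by
  induction l with
  | nil => rfl
  | cons x l ih =>
    cases l with
    | nil => rfl
    | cons y l =>
      rw [List.reverse_cons, List.reverse_cons, List.append_assoc, List.singleton_append,
        listEdges_split, ← List.reverse_cons, ih]
      simp [listEdges, Sym2.eq_swap]

theorem mem_of_mem_listEdges {l : List V} {x y : V} (h : s(x, y) ∈ listEdges l) :
    x ∈ l ∧ y ∈ l := by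
  induction l with
  | nil => simp [listEdges] at h
  | cons z l ih =>
    cases l with
    | nil => simp [listEdges] at h
    | cons w l =>
      simp only [listEdges, Set.mem_insert_iff] at h
      rcases h with h | h
      · rcases Sym2.eq_iff.1 h with ⟨rfl, rfl⟩ | ⟨rfl, rfl⟩ <;> simp
      · exact ⟨List.mem_cons_of_mem _ (ih h).1, List.mem_cons_of_mem _ (ih h).2⟩

theorem listEdges_subset {G : SimpleGraph V} {l : List V} (hl : l.IsChain G.Adj) :
    listEdges l ⊆ G.edgeSet := by
  induction l with
  | nil => simp [listEdges]
  | cons z l ih =>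
    cases l with
    | nil => simp [listEdges]
    | cons w l =>
      simp only [listEdges, Set.insert_subset_iff]
      rw [List.isChain_cons_cons] at hl
      exact ⟨hl.1, ih hl.2⟩

theorem arcEdges_append (u : V) (l₁ : List V) (r : V) (l₂ : List V) (v : V) :
    arcEdges u (l₁ ++ r :: l₂) v = arcEdges u l₁ r ∪ arcEdges r l₂ v := by
  have := listEdges_split (u :: l₁) r (l₂ ++ [v])
  simpa [arcEdges] using this

theorem arcEdges_reverse (u : V) (l : List V) (v : V) :
    arcEdges v l.reverse u = arcEdges u l v := by
  have := listEdges_reverse (u :: (l ++ [v]))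
  simpa [arcEdges] using this

theorem arc_append {G : SimpleGraph V} {u : V} {l₁ : List V} {r : V} {l₂ : List V} {v : V} :
    Arc G u (l₁ ++ r :: l₂) v ↔ Arc G u l₁ r ∧ Arc G r l₂ v := by
  have := List.isChain_split (R := G.Adj) (c := r) (l₁ := u :: l₁) (l₂ := l₂ ++ [v])
  simpa [Arc] using this

theorem arc_reverse {G : SimpleGraph V} {u : V} {l : List V} {v : V} :
    Arc G v l.reverse u ↔ Arc G u l v := by
  have := List.isChain_reverse (R := G.Adj) (l := u :: (l ++ [v]))
  simpa [Arc, G.adj_comm] using this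

theorem Arc.edges_subset {G : SimpleGraph V} {u v : V} {l : List V} (h : Arc G u l v) :
    arcEdges u l v ⊆ G.edgeSet := listEdges_subset h

theorem Arc.exists_head {G : SimpleGraph V} {u v : V} {l : List V} (h : Arc G u l v) :
    ∃ n, G.Adj u n ∧ s(u, n) ∈ arcEdges u l v ∧ (l = [] ∧ n = v ∨ n ∈ l) := by
  cases l with
  | nil => exact ⟨v, by simpa [Arc] using h, by simp [arcEdges, listEdges], by simp⟩
  | cons x l =>
    refine ⟨x, ?_, by simp [arcEdges, listEdges], by simp⟩
    simp only [Arc, List.cons_append, List.isChain_cons_cons] at h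
    exact h.1

/-- If three arcs leave `p` along different edges of a cubic graph, every neighbour of `p` is
on one of the arcs, next to `p`. -/
theorem adj_of_three_arcs {G : SimpleGraph V} (hreg : ∀ v : V, (G.neighborSet v).encard = 3)
    {p v₁ v₂ v₃ x : V} {l₁ l₂ l₃ : List V} (h₁ : Arc G p l₁ v₁) (h₂ : Arc G p l₂ v₂)
    (h₃ : Arc G p l₃ v₃)
    (h₁₂ : ∀ n, (l₁ = [] ∧ n = v₁ ∨ n ∈ l₁) → ¬ (l₂ = [] ∧ n = v₂ ∨ n ∈ l₂))
    (h₁₃ : ∀ n, (l₁ = [] ∧ n = v₁ ∨ n ∈ l₁) → ¬ (l₃ = [] ∧ n = v₃ ∨ n ∈ l₃))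
    (h₂₃ : ∀ n, (l₂ = [] ∧ n = v₂ ∨ n ∈ l₂) → ¬ (l₃ = [] ∧ n = v₃ ∨ n ∈ l₃))
    (hx : G.Adj p x) :
    s(p, x) ∈ arcEdges p l₁ v₁ ∪ arcEdges p l₂ v₂ ∪ arcEdges p l₃ v₃ := by
  obtain ⟨n₁, a₁, e₁, m₁⟩ := h₁.exists_head
  obtain ⟨n₂, a₂, e₂, m₂⟩ := h₂.exists_head
  obtain ⟨n₃, a₃, e₃, m₃⟩ := h₃.exists_head
  have n₁₂ : n₁ ≠ n₂ := by rintro rfl; exact h₁₂ _ m₁ m₂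
  have n₁₃ : n₁ ≠ n₃ := by rintro rfl; exact h₁₃ _ m₁ m₃
  have n₂₃ : n₂ ≠ n₃ := by rintro rfl; exact h₂₃ _ m₂ m₃
  obtain ⟨y₁, y₂, y₃, -, -, -, hN⟩ := Set.encard_eq_three.1 (hreg p)
  have key : ∀ z, G.Adj p z ↔ z = y₁ ∨ z = y₂ ∨ z = y₃ := fun z => by
    rw [← SimpleGraph.mem_neighborSet, hN]; simp
  have : x = n₁ ∨ x = n₂ ∨ x = n₃ := by grind
  rcases this with rfl | rfl | rfl <;> simp [*]

/-- A path of `G` from `A` to `B` with at least one edge and no inner vertex in `A ∪ B ∪ W`. -/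
theorem exists_bridge_of_path {G : SimpleGraph V} {A B W : Set V} (n : ℕ) {a b : V}
    {l : List V} (hn : l.length = n) (ha : a ∈ A) (hb : b ∈ B)
    (h : Arc G a l b) (hl : l.Nodup) (hW : ∀ x ∈ l, x ∉ W) :
    ∃ a ∈ A, ∃ b ∈ B, ∃ l, Arc G a l b ∧ l.Nodup ∧ ∀ x ∈ l, x ∉ A ∧ x ∉ B ∧ x ∉ W := by
  induction n using Nat.strong_induction_on generalizing a b l with
  | _ n ih =>
    by_cases hA : ∃ x ∈ l, x ∈ A
    · obtain ⟨x, hx, hxA⟩ := hA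
      obtain ⟨l₁, l₂, rfl⟩ := List.append_of_mem hx
      rw [arc_append] at h
      refine ih l₂.length (by simp at hn; omega) rfl hxA hb h.2 ?_ fun y hy => hW y (by simp [hy])
      exact hl.sublist (by simp)
    by_cases hB : ∃ x ∈ l, x ∈ B
    · obtain ⟨x, hx, hxB⟩ := hB
      obtain ⟨l₁, l₂, rfl⟩ := List.append_of_mem hx
      rw [arc_append] at h
      refine ih l₁.length (by simp at hn; omega) rfl ha hxB h.1 ?_ fun y hy => hW y (by simp [hy])
      exact hl.sublist (by simp)
    push Not at hA hB
    exact ⟨a, ha, b, hb, l, h, hl, fun x hx => ⟨hA x hx, hB x hx, hW x hx⟩⟩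

theorem exists_bridge {G : SimpleGraph V} {W : Set V} (hW : (G.induce Wᶜ).Connected)
    {A B : Set V} (hAB : Disjoint A B) (hAW : Disjoint A W) (hBW : Disjoint B W)
    (hA : A.Nonempty) (hB : B.Nonempty) :
    ∃ a ∈ A, ∃ b ∈ B, ∃ l, Arc G a l b ∧ l.Nodup ∧ ∀ x ∈ l, x ∉ A ∧ x ∉ B ∧ x ∉ W := by
  obtain ⟨a, ha⟩ := hA
  obtain ⟨b, hb⟩ := hB
  have haW : a ∈ Wᶜ := fun h => hAW.le_bot ⟨ha, h⟩
  have hbW : b ∈ Wᶜ := fun h => hBW.le_bot ⟨hb, h⟩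
  have hab : a ≠ b := by rintro rfl; exact hAB.le_bot ⟨ha, hb⟩
  obtain ⟨p, hp⟩ := hW.exists_isPath ⟨a, haW⟩ ⟨b, hbW⟩
  obtain ⟨l, hl⟩ : ∃ l, p.support = ⟨a, haW⟩ :: (l ++ [⟨b, hbW⟩]) := by
    cases p with
    | nil => exact absurd rfl hab
    | cons h q =>
      refine ⟨q.support.dropLast, ?_⟩
      have := q.support.dropLast_append_getLast q.support_ne_nil
      rw [SimpleGraph.Walk.getLast_support] at this
      rw [this]; simp
  have h₁ := p.isChain_adj_support
  have h₂ := hp.support_nodup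
  rw [hl] at h₁ h₂
  refine exists_bridge_of_path (W := W) _ rfl ha hb (l := l.map (↑)) ?_ ?_ ?_
  · have := List.isChain_map_of_isChain (S := G.Adj) (Subtype.val : ↥(Wᶜ) → V)
      (fun x y h => by simpa using h) h₁
    simpa [Arc] using this
  · exact (h₂.sublist (l₁ := l) (by simp)).map Subtype.val_injective
  · simp only [List.mem_map]
    rintro x ⟨y, -, rfl⟩
    exact y.2

theorem mem_listEdges_append {l₁ l₂ : List V} {x y : V} (hx : l₁.getLast? = some x)
    (hy : l₂.head? = some y) : s(x, y) ∈ listEdges (l₁ ++ l₂) := by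
  obtain ⟨l₁, rfl⟩ := List.getLast?_eq_some_iff.1 hx
  obtain ⟨l₂, rfl⟩ := List.head?_eq_some_iff.1 hy
  rw [List.append_assoc, List.singleton_append, listEdges_split]
  exact Or.inr (by simp [listEdges])

theorem isChain_append_of_adj {G : SimpleGraph V} {l₁ l₂ : List V} {x y : V}
    (h₁ : l₁.IsChain G.Adj) (h₂ : l₂.IsChain G.Adj) (hx : l₁.getLast? = some x)
    (hy : l₂.head? = some y) (hxy : G.Adj x y) : (l₁ ++ l₂).IsChain G.Adj := by
  rw [List.isChain_append]
  refine ⟨h₁, h₂, fun a ha b hb => ?_⟩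
  rw [hx, Option.mem_some_iff] at ha
  rw [hy, Option.mem_some_iff] at hb
  exact ha ▸ hb ▸ hxy

/-- Through every vertex `z` there is a path joining the ends of the edge `xy`. -/
theorem exists_path_through {G : SimpleGraph V} (hG : KConnected G 3) {x y : V}
    (hxy : G.Adj x y) (z : V) :
    ∃ l : List V, l.IsChain G.Adj ∧ l.Nodup ∧ l.head? = some x ∧ l.getLast? = some y ∧ z ∈ l := by
  classical
  by_contra hz
  let P : Set V := {z | ∃ l : List V, l.IsChain G.Adj ∧ l.Nodup ∧ l.head? = some x ∧
    l.getLast? = some y ∧ z ∈ l}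
  obtain ⟨p, ⟨l, hc, hn, hx, hy, hp⟩, q, hq, m, hm, -, hm'⟩ :=
    exists_bridge (hG ∅ (by simp)) (A := P) (B := Pᶜ) disjoint_compl_right (by simp) (by simp)
      ⟨x, [x, y], by simpa using hxy, by simpa using hxy.ne, by simp, by simp, by simp⟩ ⟨z, hz⟩
  have hm0 : m = [] := List.eq_nil_iff_forall_not_mem.2 fun v hv =>
    (hm' v hv).2.1 (hm' v hv).1
  subst hm0
  have hpq : G.Adj p q := by simpa [Arc] using hm
  have hql : q ∉ l := fun h => hq ⟨l, hc, hn, hx, hy, h⟩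
  have hne : ∃ w ∈ l, w ≠ p := by
    by_contra! h
    have hxl := List.mem_of_mem_head? hx
    have hyl := List.mem_of_getLast? hy
    exact hxy.ne ((h _ hxl).trans (h _ hyl).symm)
  obtain ⟨q', hq', w, ⟨hw, hwp⟩, m, hm, hmn, hm'⟩ :=
    exists_bridge (hG {p} (by simp)) (A := {q}) (B := {w | w ∈ l ∧ w ≠ p})
      (by simp [hql]) (by simpa using hpq.ne') (by simp) ⟨q, rfl⟩ hne
  obtain rfl : q = q' := hq'.symm
  have hml : ∀ v ∈ m, v ∉ l := fun v hv hvl => by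
    have := hm' v hv
    simp at this
    tauto
  have hqm : q ∉ m := fun h => (hm' _ h).1 rfl
  have hnew : (l ++ q :: m).Nodup := by
    rw [List.nodup_append]
    refine ⟨hn, by simp [hqm, hmn], ?_⟩
    rintro a ha b hb rfl
    rcases List.mem_cons.1 hb with rfl | hb
    exacts [hql ha, hml _ hb ha]
  rw [List.nodup_iff_count_le_one] at hnew
  obtain ⟨l₁, l₂, rfl⟩ := List.append_of_mem hp
  simp only [List.mem_append, List.mem_cons] at hw
  rw [List.isChain_split] at hc
  apply hq
  rcases hw with hw | hw | hw
  · obtain ⟨k₁, k₂, rfl⟩ := List.append_of_mem hw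
    refine ⟨k₁ ++ w :: (m.reverse ++ q :: p :: l₂), ?_, ?_, ?_, ?_, by simp⟩
    · rw [List.isChain_split]
      have h₁ := hc.1
      rw [List.append_assoc, List.cons_append, List.isChain_split] at h₁
      refine ⟨h₁.1, ?_⟩
      rw [← arc_reverse] at hm
      have := List.isChain_split (R := G.Adj) (c := q) (l₁ := w :: m.reverse) (l₂ := p :: l₂)
      rw [List.cons_append] at this
      rw [this, List.isChain_cons_cons]
      exact ⟨hm, hpq.symm, hc.2⟩
    · rw [List.nodup_iff_count_le_one]
      intro v
      specialize hnew v
      simp only [List.count_append, List.count_cons, List.count_reverse] at hnew ⊢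
      omega
    · simpa [List.head?_append] using hx
    · simpa [List.getLast?_append, List.getLast?_cons] using hy
  · exact absurd hw hwp
  · obtain ⟨k₁, k₂, rfl⟩ := List.append_of_mem hw
    refine ⟨l₁ ++ p :: q :: (m ++ w :: k₂), ?_, ?_, ?_, ?_, by simp⟩
    · rw [List.isChain_split]
      have h₁ := hc.2
      rw [← List.cons_append, List.isChain_split] at h₁
      refine ⟨hc.1, ?_⟩
      have := List.isChain_split (R := G.Adj) (c := w) (l₁ := q :: m) (l₂ := k₂)
      rw [List.cons_append] at this
      rw [List.isChain_cons_cons, this]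
      exact ⟨hpq, hm, h₁.2⟩
    · rw [List.nodup_iff_count_le_one]
      intro v
      specialize hnew v
      simp only [List.count_append, List.count_cons] at hnew ⊢
      omega
    · simpa [List.head?_append] using hx
    · simpa [List.getLast?_append, List.getLast?_cons] using hy

theorem exists_first_mem {l : List V} {A : Set V} {h : V} (hl : h ∈ l) (hA : h ∈ A) :
    ∃ l₁, ∃ h ∈ A, ∃ l₂, l = l₁ ++ h :: l₂ ∧ ∀ x ∈ l₁, x ∉ A := by
  induction l with
  | nil => simp at hl
  | cons x l ih =>
    by_cases hx : x ∈ A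
    · exact ⟨[], x, hx, l, by simp⟩
    · have : h ∈ l := by
        rcases List.mem_cons.1 hl with rfl | hl
        exacts [absurd hA hx, hl]
      obtain ⟨l₁, h, hA, l₂, rfl, hl₁⟩ := ih this
      exact ⟨x :: l₁, h, hA, l₂, rfl, by simpa [hx] using hl₁⟩

/-- Every edge of a 3-connected graph lies on a path joining two vertices of a given set `A`,
with no inner vertex in `A`. -/
theorem exists_ear {G : SimpleGraph V} (hG : KConnected G 3) {A : Set V} (hA : A.Nontrivial)
    {x y : V} (hxy : G.Adj x y) :
    ∃ u ∈ A, ∃ v ∈ A, ∃ l, Arc G u l v ∧ (u :: v :: l).Nodup ∧ (∀ z ∈ l, z ∉ A) ∧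
      s(x, y) ∈ arcEdges u l v := by
  classical
  obtain ⟨h₀, hh₀⟩ := hA.nonempty
  obtain ⟨l, hc, hn, hx, hy, hl⟩ := exists_path_through hG hxy h₀
  obtain ⟨l₁, h, hhA, l₂, rfl, hl₁⟩ := exists_first_mem hl hh₀
  have hn' := hn
  rw [List.nodup_iff_count_le_one] at hn
  have hc' := List.isChain_split.1 hc
  have hc₁ : (h :: l₁.reverse).IsChain G.Adj := by
    have := List.isChain_reverse.2 (hc'.1.imp fun a b (hab : G.Adj a b) => hab.symm)
    simpa using this
  have hx₁ : (h :: l₁.reverse).getLast? = some x := by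
    simpa [List.getLast?_cons, List.head?_append, Option.or_some] using hx
  have hy₁ : (h :: l₂).getLast? = some y := by
    simpa [List.getLast?_append, List.getLast?_cons] using hy
  by_cases h2 : ∃ k ∈ l₂, k ∈ A
  · obtain ⟨k, hk, hkA⟩ := h2
    obtain ⟨m₁, k, hkA, m₂, hm, hm₁⟩ := exists_first_mem (List.mem_reverse.2 hk) hkA
    have hl₂ : l₂ = m₂.reverse ++ k :: m₁.reverse := by
      rw [← List.reverse_reverse l₂, hm]; simp
    subst hl₂
    have hyk : (m₁ ++ [k]).head? = some y := by
      simpa [List.getLast?_cons, List.getLast?_append, List.head?_append] using hy₁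
    have hck : (m₁ ++ [k]).IsChain G.Adj := by
      have := hc'.2
      rw [← List.cons_append, List.isChain_split] at this
      have := List.isChain_reverse.2 (this.2.imp fun a b (hab : G.Adj a b) => hab.symm)
      simpa using this
    refine ⟨h, hhA, k, hkA, l₁.reverse ++ m₁, ?_, ?_, ?_, ?_⟩
    · have := isChain_append_of_adj hc₁ hck hx₁ hyk hxy
      simpa [Arc] using this
    · rw [List.nodup_iff_count_le_one]
      intro v
      specialize hn v
      simp only [List.count_append, List.count_cons, List.count_reverse] at hn ⊢
      omega
    · intro z hz
      rcases List.mem_append.1 hz with hz | hz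
      exacts [hl₁ z (by simpa using hz), hm₁ z hz]
    · have := mem_listEdges_append hx₁ hyk
      simpa [arcEdges] using this
  · push Not at h2
    obtain ⟨g₀, hg₀, hgh₀⟩ := hA.exists_ne h
    have hne : ∃ w ∈ l₁ ++ h :: l₂, w ≠ h := by
      by_contra! H
      have hxl := List.mem_of_mem_head? hx
      have hyl := List.mem_of_getLast? hy
      exact hxy.ne ((H _ hxl).trans (H _ hyl).symm)
    obtain ⟨g, ⟨hgA, hgh⟩, w, ⟨hw, hwh⟩, m, hm, hmn, hm'⟩ :=
      exists_bridge (hG {h} (by simp)) (A := A \ {h})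
        (B := {w | w ∈ l₁ ++ h :: l₂ ∧ w ≠ h})
        (by
          rw [Set.disjoint_left]
          rintro a ⟨ha, hah⟩ ⟨hal, -⟩
          have : a ∈ l₁ ∨ a ∈ l₂ := by simpa [show a ≠ h from hah] using hal
          rcases this with ha' | ha'
          exacts [hl₁ _ ha' ha, h2 _ ha' ha])
        (by simp) (by simp) ⟨g₀, hg₀, hgh₀⟩ hne
    have hgl : g ∉ l₁ ++ h :: l₂ := fun H => by
      have : g ∈ l₁ ∨ g ∈ l₂ := by simpa [show g ≠ h from hgh] using H
      rcases this with ha' | ha'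
      exacts [hl₁ _ ha' hgA, h2 _ ha' hgA]
    have hgm : g ∉ m := fun H => (hm' _ H).1 ⟨hgA, hgh⟩
    have hml : ∀ v ∈ m, v ∉ l₁ ++ h :: l₂ := fun v hv hvl => by
      have := hm' v hv
      simp only [Set.mem_ofPred_eq, Set.mem_singleton_iff] at this
      tauto
    have hmA : ∀ v ∈ m, v ∉ A := fun v hv hvA => by
      have := hm' v hv
      simp only [Set.mem_sdiff, Set.mem_singleton_iff] at this
      tauto
    have hnew : (l₁ ++ h :: l₂ ++ g :: m).Nodup := by
      rw [List.nodup_append]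
      refine ⟨hn', by simp [hgm, hmn], ?_⟩
      rintro a ha b hb rfl
      rcases List.mem_cons.1 hb with rfl | hb
      exacts [hgl ha, hml _ hb ha]
    rw [List.nodup_iff_count_le_one] at hnew
    simp only [List.mem_append, List.mem_cons] at hw
    have hm₂ : Arc G w m.reverse g := arc_reverse.2 hm
    rcases hw with hw | hw | hw
    · obtain ⟨k₁, k₂, rfl⟩ := List.append_of_mem hw
      have hck : (k₁ ++ w :: (m.reverse ++ [g])).IsChain G.Adj := by
        have h₁ := hc'.1
        rw [List.append_assoc, List.cons_append, List.isChain_split] at h₁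
        exact List.isChain_split.2 ⟨h₁.1, hm₂⟩
      have hxk : (k₁ ++ w :: (m.reverse ++ [g])).head? = some x := by
        simpa [List.head?_append] using hx
      refine ⟨h, hhA, g, hgA, l₂ ++ k₁ ++ w :: m.reverse, ?_, ?_, ?_, ?_⟩
      · have := isChain_append_of_adj hc'.2 hck hy₁ hxk hxy.symm
        simpa [Arc] using this
      · rw [List.nodup_iff_count_le_one]
        intro v
        specialize hnew v
        simp only [List.count_append, List.count_cons, List.count_reverse] at hnew ⊢
        omega
      · intro z hz
        simp only [List.mem_append, List.mem_cons, List.mem_reverse] at hz hl₁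
        have := h2 z; have := hl₁ z; have := hmA z
        tauto
      · have := mem_listEdges_append hy₁ hxk
        rw [Sym2.eq_swap]
        simpa [arcEdges] using this
    · exact absurd hw hwh
    · obtain ⟨k₁, k₂, rfl⟩ := List.append_of_mem hw
      have hck : (k₂.reverse ++ w :: (m.reverse ++ [g])).IsChain G.Adj := by
        have h₁ := hc'.2
        rw [← List.cons_append, List.isChain_split] at h₁
        have := List.isChain_reverse.2 (h₁.2.imp fun a b (hab : G.Adj a b) => hab.symm)
        exact List.isChain_split.2 ⟨by simpa using this, hm₂⟩
      have hyk : (k₂.reverse ++ w :: (m.reverse ++ [g])).head? = some y := by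
        simpa [List.head?_append, List.getLast?_append, List.getLast?_cons] using hy₁
      refine ⟨h, hhA, g, hgA, l₁.reverse ++ k₂.reverse ++ w :: m.reverse, ?_, ?_, ?_, ?_⟩
      · have := isChain_append_of_adj hc₁ hck hx₁ hyk hxy
        simpa [Arc] using this
      · rw [List.nodup_iff_count_le_one]
        intro v
        specialize hnew v
        simp only [List.count_append, List.count_cons, List.count_reverse] at hnew ⊢
        omega
      · intro z hz
        simp only [List.mem_append, List.mem_cons, List.mem_reverse] at hz h2
        have := h2 z; have := hl₁ z; have := hmA z
        tauto
      · have := mem_listEdges_append hx₁ hyk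
        simpa [arcEdges] using this

/-- Three internally disjoint arcs from `a` to `b`, at most one of them a single edge. -/
structure IsTheta (G : SimpleGraph V) (a b : V) (l₁ l₂ l₃ : List V) : Prop where
  arc₁ : Arc G a l₁ b
  arc₂ : Arc G a l₂ b
  arc₃ : Arc G a l₃ b
  nodup : (a :: b :: (l₁ ++ l₂ ++ l₃)).Nodup
  ne₁₂ : l₁ ≠ [] ∨ l₂ ≠ []
  ne₁₃ : l₁ ≠ [] ∨ l₃ ≠ []
  ne₂₃ : l₂ ≠ [] ∨ l₃ ≠ []

/-- The edges in `F` lie on a common θ-graph in `G`. -/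
def HasTheta (G : SimpleGraph V) (F : Set (Sym2 V)) : Prop :=
  ∃ a b l₁ l₂ l₃, IsTheta G a b l₁ l₂ l₃ ∧ F ⊆ arcEdges a l₁ b ∪ arcEdges a l₂ b ∪ arcEdges a l₃ b

theorem HasTheta.mono {G : SimpleGraph V} {F F' : Set (Sym2 V)} (h : HasTheta G F')
    (hF : F ⊆ F') : HasTheta G F := by
  obtain ⟨a, b, l₁, l₂, l₃, h, h_sub⟩ := h
  exact ⟨a, b, l₁, l₂, l₃, h, hF.trans h_sub⟩

/-- Two disjoint cycles (`d ∪ d'` through `a, b` and `c ∪ c'` through `p, q`) joined by the disjoint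
arcs `s` from `a` to `p` and `t` from `b` to `q`. -/
structure IsBag (G : SimpleGraph V) (a b p q : V) (d d' c c' s t : List V) : Prop where
  arc_d : Arc G a d b
  arc_d' : Arc G a d' b
  arc_c : Arc G p c q
  arc_c' : Arc G p c' q
  arc_s : Arc G a s p
  arc_t : Arc G b t q
  nodup : (a :: b :: p :: q :: (d ++ d' ++ c ++ c' ++ s ++ t)).Nodup
  ne_d : d ≠ [] ∨ d' ≠ []
  ne_c : c ≠ [] ∨ c' ≠ []

section

variable {G : SimpleGraph V} {a b p q r k : V} {l₁ l₂ l₃ d d' c c' s t u₁ u₂ w₁ w₂ Q : List V}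

theorem IsTheta.swap₁₂ (h : IsTheta G a b l₁ l₂ l₃) : IsTheta G a b l₂ l₁ l₃ := by
  classical
  refine ⟨h.arc₂, h.arc₁, h.arc₃, ?_, h.ne₁₂.symm, h.ne₂₃, h.ne₁₃⟩
  have hn := h.nodup
  rw [List.nodup_iff_count_le_one] at *
  intro v
  specialize hn v
  simp only [List.count_append, List.count_cons] at hn ⊢
  omega

theorem IsTheta.swap₂₃ (h : IsTheta G a b l₁ l₂ l₃) : IsTheta G a b l₁ l₃ l₂ := by
  classical
  refine ⟨h.arc₁, h.arc₃, h.arc₂, ?_, h.ne₁₃, h.ne₁₂, h.ne₂₃.symm⟩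
  have hn := h.nodup
  rw [List.nodup_iff_count_le_one] at *
  intro v
  specialize hn v
  simp only [List.count_append, List.count_cons] at hn ⊢
  omega

theorem IsTheta.flip (h : IsTheta G a b l₁ l₂ l₃) :
    IsTheta G b a l₁.reverse l₂.reverse l₃.reverse := by
  classical
  refine ⟨arc_reverse.2 h.arc₁, arc_reverse.2 h.arc₂, arc_reverse.2 h.arc₃, ?_,
    by simpa using h.ne₁₂, by simpa using h.ne₁₃, by simpa using h.ne₂₃⟩
  have hn := h.nodup
  rw [List.nodup_iff_count_le_one] at *
  intro v
  specialize hn v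
  simp only [List.count_append, List.count_cons, List.count_reverse] at hn ⊢
  omega

theorem IsBag.swap_d (h : IsBag G a b p q d d' c c' s t) : IsBag G a b p q d' d c c' s t := by
  classical
  refine ⟨h.arc_d', h.arc_d, h.arc_c, h.arc_c', h.arc_s, h.arc_t, ?_, h.ne_d.symm, h.ne_c⟩
  have hn := h.nodup
  rw [List.nodup_iff_count_le_one] at *
  intro v
  specialize hn v
  simp only [List.count_append, List.count_cons] at hn ⊢
  omega

theorem IsBag.swap_c (h : IsBag G a b p q d d' c c' s t) : IsBag G a b p q d d' c' c s t := by
  classical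
  refine ⟨h.arc_d, h.arc_d', h.arc_c', h.arc_c, h.arc_s, h.arc_t, ?_, h.ne_d, h.ne_c.symm⟩
  have hn := h.nodup
  rw [List.nodup_iff_count_le_one] at *
  intro v
  specialize hn v
  simp only [List.count_append, List.count_cons] at hn ⊢
  omega

theorem IsBag.flip (h : IsBag G a b p q d d' c c' s t) :
    IsBag G b a q p d.reverse d'.reverse c.reverse c'.reverse t s := by
  classical
  refine ⟨arc_reverse.2 h.arc_d, arc_reverse.2 h.arc_d', arc_reverse.2 h.arc_c,
    arc_reverse.2 h.arc_c', h.arc_t, h.arc_s, ?_, by simpa using h.ne_d, by simpa using h.ne_c⟩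
  have hn := h.nodup
  rw [List.nodup_iff_count_le_one] at *
  intro v
  specialize hn v
  simp only [List.count_append, List.count_cons, List.count_reverse] at hn ⊢
  omega

theorem IsBag.mirror (h : IsBag G a b p q d d' c c' s t) :
    IsBag G p q a b c c' d d' s.reverse t.reverse := by
  classical
  refine ⟨h.arc_c, h.arc_c', h.arc_d, h.arc_d', arc_reverse.2 h.arc_s, arc_reverse.2 h.arc_t, ?_,
    h.ne_c, h.ne_d⟩
  have hn := h.nodup
  rw [List.nodup_iff_count_le_one] at *
  intro v
  specialize hn v
  simp only [List.count_append, List.count_cons, List.count_reverse] at hn ⊢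
  omega

/-- Deleting `d` from a baguette leaves a θ-graph. -/
theorem IsBag.hasTheta_delete_d (h : IsBag G a b p q d d' c c' s t) :
    HasTheta G (arcEdges a d' b ∪ arcEdges p c q ∪ arcEdges p c' q ∪ arcEdges a s p ∪
      arcEdges b t q) := by
  classical
  obtain ⟨hd, hd', hc, hc', hs, ht, hn, -, hne⟩ := h
  refine ⟨p, q, c, c', s.reverse ++ a :: (d' ++ b :: t), ⟨hc, hc', ?_, ?_, hne, by simp, by simp⟩,
    ?_⟩
  · simp only [arc_append, arc_reverse]
    tauto
  · rw [List.nodup_iff_count_le_one] at *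
    intro v
    specialize hn v
    simp only [List.count_append, List.count_cons, List.count_reverse] at hn ⊢
    omega
  · intro e
    simp only [arcEdges_append, arcEdges_reverse, Set.mem_union]
    tauto

/-- A baguette with an additional arc `Q` from `d` to the vertex `k` of `s`. -/
theorem hasTheta_of_chord_s (h : IsBag G a b p q (u₁ ++ r :: u₂) d' c c' (w₁ ++ k :: w₂) t)
    (hQ : Arc G r Q k)
    (hn : (a :: b :: p :: q :: (u₁ ++ r :: u₂ ++ d' ++ c ++ c' ++ (w₁ ++ k :: w₂) ++ t ++ Q)).Nodup) :
    HasTheta G (arcEdges a u₁ r ∪ arcEdges a d' b ∪ arcEdges p c q ∪ arcEdges p c' q ∪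
      arcEdges k w₂ p ∪ arcEdges b t q) := by
  classical
  obtain ⟨hd, hd', hc, hc', hs, ht, -, -, hne⟩ := h
  rw [arc_append] at hd hs
  refine ⟨p, q, c, c', w₂.reverse ++ k :: (Q.reverse ++ r :: (u₁.reverse ++ a :: (d' ++ b :: t))),
    ⟨hc, hc', ?_, ?_, hne, by simp, by simp⟩, ?_⟩
  · simp only [arc_append, arc_reverse]
    tauto
  · rw [List.nodup_iff_count_le_one] at *
    intro v
    specialize hn v
    simp only [List.count_append, List.count_cons, List.count_reverse] at hn ⊢
    omega
  · intro e
    simp only [arcEdges_append, arcEdges_reverse, Set.mem_union]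
    tauto

/-- A baguette with an additional arc `Q` from `d` to the vertex `k` of `c`. -/
theorem hasTheta_of_chord_c (h : IsBag G a b p q (u₁ ++ r :: u₂) d' (w₁ ++ k :: w₂) c' s t)
    (hQ : Arc G r Q k)
    (hn : (a :: b :: p :: q :: (u₁ ++ r :: u₂ ++ d' ++ (w₁ ++ k :: w₂) ++ c' ++ s ++ t ++ Q)).Nodup) :
    HasTheta G (arcEdges a u₁ r ∪ arcEdges a d' b ∪ arcEdges p w₁ k ∪ arcEdges k w₂ q ∪
      arcEdges p c' q) ∧
    HasTheta G (arcEdges a u₁ r ∪ arcEdges a d' b ∪ arcEdges p w₁ k ∪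
      arcEdges p c' q ∪ arcEdges a s p ∪ arcEdges b t q) ∧
    HasTheta G (arcEdges a u₁ r ∪ arcEdges a d' b ∪ arcEdges k w₂ q ∪
      arcEdges p c' q ∪ arcEdges a s p ∪ arcEdges b t q) := by
  classical
  obtain ⟨hd, hd', hc, hc', hs, ht, -, -, -⟩ := h
  rw [arc_append] at hd hc
  rw [List.nodup_iff_count_le_one] at hn
  refine ⟨⟨q, k, w₂.reverse, c'.reverse ++ p :: w₁,
      t.reverse ++ b :: (d'.reverse ++ a :: (u₁ ++ r :: Q)),
      ⟨?_, ?_, ?_, ?_, by simp, by simp, by simp⟩, ?_⟩,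
    ⟨a, p, s, d' ++ b :: (t ++ q :: c'.reverse), u₁ ++ r :: (Q ++ k :: w₁.reverse),
      ⟨?_, ?_, ?_, ?_, by simp, by simp, by simp⟩, ?_⟩,
    ⟨a, q, s ++ p :: c', d' ++ b :: t, u₁ ++ r :: (Q ++ k :: w₂),
      ⟨?_, ?_, ?_, ?_, by simp, by simp, by simp⟩, ?_⟩⟩
  case refine_4 | refine_9 | refine_14 =>
    rw [List.nodup_iff_count_le_one]
    intro v
    specialize hn v
    simp only [List.count_append, List.count_cons, List.count_reverse] at hn ⊢
    omega
  case refine_5 | refine_10 | refine_15 =>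
    intro e
    simp only [arcEdges_append, arcEdges_reverse, Set.mem_union]
    tauto
  all_goals
    try simp only [arc_append, arc_reverse]
    tauto

/-- An additional arc `Q` from `d` to `t` yields a baguette with a shorter arc `t`. -/
theorem isBag_of_chord_t (h : IsBag G a b p q (u₁ ++ r :: u₂) d' c c' s (w₁ ++ k :: w₂))
    (hQ : Arc G r Q k)
    (hn : (a :: b :: p :: q :: (u₁ ++ r :: u₂ ++ d' ++ c ++ c' ++ s ++ (w₁ ++ k :: w₂) ++ Q)).Nodup) :
    IsBag G a k p q (u₁ ++ r :: Q) (d' ++ b :: w₁) c c' s w₂ := by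
  classical
  obtain ⟨hd, hd', hc, hc', hs, ht, -, -, hne⟩ := h
  rw [arc_append] at hd ht
  refine ⟨?_, ?_, hc, hc', hs, ht.2, ?_, by simp, hne⟩
  · simp only [arc_append]
    tauto
  · simp only [arc_append]
    tauto
  · rw [List.nodup_iff_count_le_one] at *
    intro v
    specialize hn v
    simp only [List.count_append, List.count_cons] at hn ⊢
    omega

/-- A baguette with two disjoint additional arcs, `Q` from `d` to `s` and `R` from `c` to `s`, their
ends in `s` being interlaced: all but four of the resulting arcs form a cycle with a chord. -/
theorem hasTheta_of_two_chords {g j : V} {s₁ s₂ s₃ R : List V}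
    (h : IsBag G a b p q (u₁ ++ r :: u₂) d' (w₁ ++ j :: w₂) c' (s₁ ++ g :: (s₂ ++ k :: s₃)) t)
    (hQ : Arc G r Q k) (hR : Arc G j R g)
    (hn : (a :: b :: p :: q :: (u₁ ++ r :: u₂ ++ d' ++ (w₁ ++ j :: w₂) ++ c' ++
      (s₁ ++ g :: (s₂ ++ k :: s₃)) ++ t ++ Q ++ R)).Nodup) :
    HasTheta G (arcEdges a u₁ r ∪ arcEdges a d' b ∪ arcEdges p w₁ j ∪ arcEdges p c' q ∪
      arcEdges g s₂ k) := by
  classical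
  obtain ⟨hd, hd', hc, hc', hs, ht, -, -, -⟩ := h
  rw [arc_append] at hd hc hs
  rw [arc_append] at hs
  refine ⟨r, b, u₂, u₁.reverse ++ a :: d',
    Q ++ k :: (s₂.reverse ++ g :: (R.reverse ++ j :: (w₁.reverse ++ p :: (c' ++ q :: t.reverse)))),
    ⟨hd.2, ?_, ?_, ?_, by simp, by simp, by simp⟩, ?_⟩
  · simp only [arc_append, arc_reverse]
    tauto
  · simp only [arc_append, arc_reverse]
    tauto
  · rw [List.nodup_iff_count_le_one] at *
    intro v
    specialize hn v
    simp only [List.count_append, List.count_cons, List.count_reverse] at hn ⊢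
    omega
  · intro e
    simp only [arcEdges_append, arcEdges_reverse, Set.mem_union]
    tauto

end

theorem heads_disjoint {l₁ l₂ : List V} {v₁ v₂ : V} (h₁ : (v₁ :: (l₁ ++ l₂)).Nodup)
    (h₂ : (v₂ :: (l₁ ++ l₂)).Nodup) (h : v₁ = v₂ → l₁ ≠ [] ∨ l₂ ≠ []) (n : V) :
    (l₁ = [] ∧ n = v₁ ∨ n ∈ l₁) → ¬ (l₂ = [] ∧ n = v₂ ∨ n ∈ l₂) := by
  simp only [List.nodup_cons, List.mem_append, List.nodup_append] at h₁ h₂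
  rintro (⟨rfl, rfl⟩ | h₃) (⟨rfl, rfl⟩ | h₄)
  · simpa using h rfl
  · exact h₁.1 (Or.inr h₄)
  · exact h₂.1 (Or.inl h₃)
  · exact h₁.2.2.2 _ h₃ _ h₄ rfl

section

variable {G : SimpleGraph V} {a b p q r k : V} {d d' c c' s t u₁ u₂ w₁ w₂ Q : List V}

theorem IsBag.adj_of_p (hreg : ∀ v : V, (G.neighborSet v).encard = 3)
    (h : IsBag G a b p q d d' c c' s t) {x : V} (hx : G.Adj p x) :
    x ∈ a :: p :: q :: (c ++ c' ++ s) := by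
  classical
  have hn := h.nodup
  rw [List.nodup_iff_count_le_one] at hn
  have key := adj_of_three_arcs hreg h.arc_c h.arc_c' (arc_reverse.2 h.arc_s)
    (heads_disjoint ?_ ?_ fun _ => h.ne_c) (heads_disjoint ?_ ?_ ?_)
    (heads_disjoint ?_ ?_ ?_) hx
  · have : x ∈ p :: (c ++ [q]) ∨ x ∈ p :: (c' ++ [q]) ∨ x ∈ p :: (s.reverse ++ [a]) := by
      rcases key with (h | h) | h
      exacts [.inl (mem_of_mem_listEdges h).2, .inr (.inl (mem_of_mem_listEdges h).2),
        .inr (.inr (mem_of_mem_listEdges h).2)]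
    simp only [List.mem_append, List.mem_cons, List.mem_reverse, List.not_mem_nil] at this ⊢
    tauto
  case refine_5 | refine_8 =>
    intro hqa
    specialize hn q
    simp only [List.count_append, List.count_cons, hqa, beq_self_eq_true, if_true] at hn
    omega
  all_goals
    rw [List.nodup_iff_count_le_one]
    intro v
    specialize hn v
    simp only [List.count_append, List.count_cons, List.count_reverse] at hn ⊢
    omega

/-- An arc leaves `d` or `d'` and lands on one of the other arcs of a baguette. -/
theorem IsBag.exists_chord (hreg : ∀ v : V, (G.neighborSet v).encard = 3) (hG : KConnected G 3)
    (h : IsBag G a b p q d d' c c' s t) :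
    ∃ r k Q, (r ∈ d ∨ r ∈ d') ∧ (k ∈ c ∨ k ∈ c' ∨ k ∈ s ∨ k ∈ t) ∧ Arc G r Q k ∧
      (a :: b :: p :: q :: (d ++ d' ++ c ++ c' ++ s ++ t ++ Q)).Nodup := by
  classical
  have hn := h.nodup
  rw [List.nodup_iff_count_le_one] at hn
  have hne : ∃ x, x ∈ d ++ d' := by
    rcases h.ne_d with h | h
    all_goals
      obtain ⟨x, hx⟩ := List.exists_mem_of_ne_nil _ h
      exact ⟨x, by simp [hx]⟩
  have hAB : Disjoint {x | x ∈ d ++ d'} {x | x ∈ p :: q :: (c ++ c' ++ s ++ t)} := by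
    rw [Set.disjoint_left]
    intro x h₁ h₂
    rw [Set.mem_ofPred_eq, ← List.count_pos_iff] at h₁ h₂
    specialize hn x
    simp only [List.count_append, List.count_cons] at hn h₁ h₂
    omega
  have hAW : Disjoint {x | x ∈ d ++ d'} {a, b} := by
    rw [Set.disjoint_left]
    intro x h₁ h₂
    have h₂ : x ∈ [a, b] := by simpa using h₂
    rw [Set.mem_ofPred_eq, ← List.count_pos_iff] at h₁
    rw [← List.count_pos_iff] at h₂
    specialize hn x
    simp only [List.count_append, List.count_cons, List.count_nil] at hn h₁ h₂
    omega
  have hBW : Disjoint {x | x ∈ p :: q :: (c ++ c' ++ s ++ t)} {a, b} := by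
    rw [Set.disjoint_left]
    intro x h₁ h₂
    have h₂ : x ∈ [a, b] := by simpa using h₂
    rw [Set.mem_ofPred_eq, ← List.count_pos_iff] at h₁
    rw [← List.count_pos_iff] at h₂
    specialize hn x
    simp only [List.count_append, List.count_cons, List.count_nil] at hn h₁ h₂
    omega
  obtain ⟨r, hr, k, hk, Q, hQ, hQn, hQ'⟩ := exists_bridge
    (hG {a, b} ((Set.encard_insert_le _ _).trans_lt (by norm_num))) hAB hAW hBW hne ⟨p, by simp⟩
  have hrB : r ∉ a :: b :: p :: q :: (c ++ c' ++ s ++ t) := fun h₁ => by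
    rw [Set.mem_ofPred_eq, ← List.count_pos_iff] at hr
    rw [← List.count_pos_iff] at h₁
    specialize hn r
    simp only [List.count_append, List.count_cons] at hn hr h₁
    omega
  have hQB : ∀ x ∈ Q, x ∉ a :: b :: p :: q :: (d ++ d' ++ c ++ c' ++ s ++ t) := fun x hx h₁ => by
    have := hQ' x hx
    simp only [Set.mem_ofPred_eq, Set.mem_insert_iff, Set.mem_singleton_iff, List.mem_append,
      List.mem_cons] at this h₁
    tauto
  obtain ⟨x, hkx, -, hx⟩ := (arc_reverse.2 hQ).exists_head
  have hx' : x ∉ a :: b :: p :: q :: (c ++ c' ++ s ++ t) := by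
    rcases hx with ⟨-, rfl⟩ | hx
    · exact hrB
    · have := hQB x (by simpa using hx)
      simp only [List.mem_append, List.mem_cons] at this ⊢
      tauto
  refine ⟨r, k, Q, by simpa using hr, ?_, hQ, ?_⟩
  · have hk' : k = p ∨ k = q ∨ k ∈ c ∨ k ∈ c' ∨ k ∈ s ∨ k ∈ t := by simpa using hk
    simp only [List.mem_append, List.mem_cons] at hx'
    rcases hk' with rfl | rfl | hk'
    · have := h.adj_of_p hreg hkx
      simp only [List.mem_append, List.mem_cons] at this
      tauto
    · have := h.flip.adj_of_p hreg hkx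
      simp only [List.mem_append, List.mem_cons, List.mem_reverse] at this
      tauto
    · exact hk'
  · rw [← List.cons_append, ← List.cons_append, ← List.cons_append, ← List.cons_append,
      List.nodup_append]
    refine ⟨h.nodup, hQn, ?_⟩
    rintro x h₁ _ h₂ rfl
    exact hQB x h₂ h₁

/-- An arc from `d` to `c` makes every choice of five labelled edges lie on a θ-graph, provided that
each of `d, d', c, c'` is labelled. -/
theorem hasTheta_of_prism {f₁ f₂ f₃ f₄ f₅ : Sym2 V}
    (h : IsBag G a b p q d d' c c' s t) (hr : r ∈ d) (hk : k ∈ c) (hQ : Arc G r Q k)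
    (hn : (a :: b :: p :: q :: (d ++ d' ++ c ++ c' ++ s ++ t ++ Q)).Nodup)
    (h₁ : f₁ ∈ arcEdges a d b) (h₂ : f₂ ∈ arcEdges a d' b) (h₃ : f₃ ∈ arcEdges p c q)
    (h₄ : f₄ ∈ arcEdges p c' q)
    (h₅ : f₅ ∈ arcEdges a d b ∪ arcEdges a d' b ∪ arcEdges p c q ∪ arcEdges p c' q ∪
      arcEdges a s p ∪ arcEdges b t q) : HasTheta G {f₁, f₂, f₃, f₄, f₅} := by
  classical
  rw [List.nodup_iff_count_le_one] at hn
  obtain ⟨u₁, u₂, rfl⟩ := List.append_of_mem hr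
  obtain ⟨w₁, w₂, rfl⟩ := List.append_of_mem hk
  have hA := hasTheta_of_chord_c h hQ (List.nodup_iff_count_le_one.2 hn)
  have hf := h.flip
  have hm := h.mirror
  have hmf := h.mirror.flip
  simp only [List.reverse_append, List.reverse_cons, List.append_assoc, List.singleton_append]
    at hf hm hmf
  have hB := hasTheta_of_chord_c hf hQ (by
    rw [List.nodup_iff_count_le_one]
    intro v
    specialize hn v
    simp only [List.count_append, List.count_cons, List.count_reverse] at hn ⊢
    omega)
  have hC := hasTheta_of_chord_c hm (arc_reverse.2 hQ) (by
    rw [List.nodup_iff_count_le_one]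
    intro v
    specialize hn v
    simp only [List.count_append, List.count_cons, List.count_reverse] at hn ⊢
    omega)
  have hD := hasTheta_of_chord_c hmf (arc_reverse.2 hQ) (by
    rw [List.nodup_iff_count_le_one]
    intro v
    specialize hn v
    simp only [List.count_append, List.count_cons, List.count_reverse] at hn ⊢
    omega)
  simp only [arcEdges_append, arcEdges_reverse, Set.mem_union] at h₁ h₃ h₅ hA hB hC hD
  have hF : ∀ S : Set (Sym2 V), HasTheta G S →
      (f₁ ∈ S ∧ f₂ ∈ S ∧ f₃ ∈ S ∧ f₄ ∈ S ∧ f₅ ∈ S) → HasTheta G {f₁, f₂, f₃, f₄, f₅} :=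
    fun S hS hfS => hS.mono (by simpa [Set.insert_subset_iff] using hfS)
  have hA₁ := hF _ hA.1
  have hA₂ := hF _ hA.2.1
  have hA₃ := hF _ hA.2.2
  have hB₁ := hF _ hB.1
  have hB₂ := hF _ hB.2.1
  have hB₃ := hF _ hB.2.2
  have hC₁ := hF _ hC.1
  have hD₁ := hF _ hD.1
  clear hA hB hC hD hF
  simp only [Set.mem_union] at hA₁ hA₂ hA₃ hB₁ hB₂ hB₃ hC₁ hD₁
  rcases h₁ with h₁ | h₁ <;> rcases h₃ with h₃ | h₃ <;>
    rcases h₅ with (((((h₅ | h₅) | h₅) | (h₅ | h₅)) | h₅) | h₅) | h₅ <;>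
    simp only [h₁, h₂, h₃, h₄, h₅, true_or, or_true, true_and, and_true, forall_const] at * <;>
    assumption

end

/-- Every choice of five labelled edges in a baguette with `s` and `t` of total length less than `n`
lies on a θ-graph, provided that each of `d, d', c, c'` is labelled. -/
def BagSolvable (G : SimpleGraph V) (n : ℕ) : Prop :=
  ∀ ⦃a b p q : V⦄ ⦃d d' c c' s t : List V⦄, IsBag G a b p q d d' c c' s t →
    s.length + t.length < n → ∀ ⦃f₁ f₂ f₃ f₄ f₅ : Sym2 V⦄, f₁ ∈ arcEdges a d b →
    f₂ ∈ arcEdges a d' b → f₃ ∈ arcEdges p c q → f₄ ∈ arcEdges p c' q →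
    f₅ ∈ arcEdges a d b ∪ arcEdges a d' b ∪ arcEdges p c q ∪ arcEdges p c' q ∪
      arcEdges a s p ∪ arcEdges b t q → HasTheta G {f₁, f₂, f₃, f₄, f₅}

section

variable {G : SimpleGraph V} {a b p q r k : V} {d d' c c' s t u₁ u₂ w₁ w₂ Q : List V}
  {f₁ f₂ f₃ f₄ f₅ : Sym2 V}

theorem hasTheta_of_land_t (h : IsBag G a b p q d d' c c' s t)
    (ih : BagSolvable G (s.length + t.length)) (hr : r ∈ d) (hk : k ∈ t) (hQ : Arc G r Q k)
    (hn : (a :: b :: p :: q :: (d ++ d' ++ c ++ c' ++ s ++ t ++ Q)).Nodup)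
    (h₁ : f₁ ∈ arcEdges a d b) (h₂ : f₂ ∈ arcEdges a d' b) (h₃ : f₃ ∈ arcEdges p c q)
    (h₄ : f₄ ∈ arcEdges p c' q) (h₅ : f₅ ∈ arcEdges p c q ∪ arcEdges p c' q ∪ arcEdges a s p) :
    HasTheta G {f₁, f₂, f₃, f₄, f₅} := by
  classical
  obtain ⟨u₁, u₂, rfl⟩ := List.append_of_mem hr
  obtain ⟨w₁, w₂, rfl⟩ := List.append_of_mem hk
  rw [arcEdges_append] at h₁
  rcases h₁ with h₁ | h₁
  · refine ih (isBag_of_chord_t h hQ hn) ?_ ?_ ?_ h₃ h₄ ?_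
    · simp only [List.length_append, List.length_cons]
      omega
    · rw [arcEdges_append]
      exact Or.inl h₁
    · rw [arcEdges_append]
      exact Or.inl h₂
    · simp only [Set.mem_union] at h₅ ⊢
      tauto
  · have hf := h.flip
    simp only [List.reverse_append, List.reverse_cons, List.append_assoc, List.singleton_append]
      at hf
    refine (hasTheta_of_chord_s hf hQ ?_).mono ?_
    · rw [List.nodup_iff_count_le_one] at *
      intro v
      specialize hn v
      simp only [List.count_append, List.count_cons, List.count_reverse] at hn ⊢
      omega
    · simp only [Set.insert_subset_iff, Set.singleton_subset_iff, Set.mem_union, arcEdges_reverse]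
        at h₅ ⊢
      tauto

theorem hasTheta_or_stuck_of_land_s (h : IsBag G a b p q d d' c c' s t)
    (ih : BagSolvable G (s.length + t.length)) (hr : r ∈ d) (hk : k ∈ s) (hQ : Arc G r Q k)
    (hn : (a :: b :: p :: q :: (d ++ d' ++ c ++ c' ++ s ++ t ++ Q)).Nodup)
    (h₁ : f₁ ∈ arcEdges a d b) (h₂ : f₂ ∈ arcEdges a d' b) (h₃ : f₃ ∈ arcEdges p c q)
    (h₄ : f₄ ∈ arcEdges p c' q) (h₅ : f₅ ∈ arcEdges a s p) :
    HasTheta G {f₁, f₂, f₃, f₄, f₅} ∨ ∃ s₁ s₂ u₁ u₂, s = s₁ ++ k :: s₂ ∧ f₅ ∈ arcEdges a s₁ k ∧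
      d = u₁ ++ r :: u₂ ∧ f₁ ∈ arcEdges a u₁ r := by
  classical
  obtain ⟨u₁, u₂, rfl⟩ := List.append_of_mem hr
  obtain ⟨w₁, w₂, rfl⟩ := List.append_of_mem hk
  rw [arcEdges_append] at h₁ h₅
  rcases h₁ with h₁ | h₁
  · rcases h₅ with h₅ | h₅
    · exact Or.inr ⟨w₁, w₂, u₁, u₂, rfl, h₅, rfl, h₁⟩
    · refine Or.inl ((hasTheta_of_chord_s h hQ hn).mono ?_)
      simp only [Set.insert_subset_iff, Set.singleton_subset_iff, Set.mem_union]
      tauto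
  · left
    have hf := h.flip
    simp only [List.reverse_append, List.reverse_cons, List.append_assoc, List.singleton_append]
      at hf
    refine ih (isBag_of_chord_t hf hQ ?_) ?_ ?_ ?_ (by rwa [arcEdges_reverse])
      (by rwa [arcEdges_reverse]) ?_
    · rw [List.nodup_iff_count_le_one] at *
      intro v
      specialize hn v
      simp only [List.count_append, List.count_cons, List.count_reverse] at hn ⊢
      omega
    · simp only [List.length_append, List.length_cons]
      omega
    · rw [arcEdges_append, arcEdges_reverse]
      exact Or.inl h₁
    · rw [arcEdges_append, arcEdges_reverse]
      exact Or.inl h₂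
    · simp only [arcEdges_append, Set.mem_union] at h₅ ⊢
      tauto

theorem hasTheta_of_chord (h : IsBag G a b p q d d' c c' s t)
    (ih : BagSolvable G (s.length + t.length)) (hr : r ∈ d)
    (hk : k ∈ c ∨ k ∈ c' ∨ k ∈ s ∨ k ∈ t) (hQ : Arc G r Q k)
    (hn : (a :: b :: p :: q :: (d ++ d' ++ c ++ c' ++ s ++ t ++ Q)).Nodup)
    (h₁ : f₁ ∈ arcEdges a d b) (h₂ : f₂ ∈ arcEdges a d' b) (h₃ : f₃ ∈ arcEdges p c q)
    (h₄ : f₄ ∈ arcEdges p c' q) (h₅ : f₅ ∈ arcEdges p c q ∪ arcEdges p c' q) :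
    HasTheta G {f₁, f₂, f₃, f₄, f₅} := by
  classical
  rcases hk with hk | hk | hk | hk
  · refine hasTheta_of_prism h hr hk hQ hn h₁ h₂ h₃ h₄ ?_
    simp only [Set.mem_union] at h₅ ⊢
    tauto
  · refine (hasTheta_of_prism (f₅ := f₅) h.swap_c hr hk hQ ?_ h₁ h₂ h₄ h₃ ?_).mono ?_
    · rw [List.nodup_iff_count_le_one] at *
      intro v
      specialize hn v
      simp only [List.count_append, List.count_cons] at hn ⊢
      omega
    · simp only [Set.mem_union] at h₅ ⊢
      tauto
    · simp [Set.insert_subset_iff]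
  · refine hasTheta_of_land_t h.flip (by rwa [Nat.add_comm]) (List.mem_reverse.2 hr) hk hQ ?_
      (by rwa [arcEdges_reverse]) (by rwa [arcEdges_reverse]) (by rwa [arcEdges_reverse])
      (by rwa [arcEdges_reverse]) (by simp only [arcEdges_reverse]; exact Or.inl h₅)
    rw [List.nodup_iff_count_le_one] at *
    intro v
    specialize hn v
    simp only [List.count_append, List.count_cons, List.count_reverse] at hn ⊢
    omega
  · exact hasTheta_of_land_t h ih hr hk hQ hn h₁ h₂ h₃ h₄ (Or.inl h₅)

theorem hasTheta_of_label_c (hreg : ∀ v : V, (G.neighborSet v).encard = 3) (hG : KConnected G 3)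
    (h : IsBag G a b p q d d' c c' s t) (ih : BagSolvable G (s.length + t.length))
    (h₁ : f₁ ∈ arcEdges a d b) (h₂ : f₂ ∈ arcEdges a d' b) (h₃ : f₃ ∈ arcEdges p c q)
    (h₄ : f₄ ∈ arcEdges p c' q) (h₅ : f₅ ∈ arcEdges p c q ∪ arcEdges p c' q) :
    HasTheta G {f₁, f₂, f₃, f₄, f₅} := by
  classical
  obtain ⟨r, k, Q, hr | hr, hk, hQ, hn⟩ := h.exists_chord hreg hG
  · exact hasTheta_of_chord h ih hr hk hQ hn h₁ h₂ h₃ h₄ h₅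
  · refine (hasTheta_of_chord (f₅ := f₅) h.swap_d ih hr hk hQ ?_ h₂ h₁ h₃ h₄ h₅).mono ?_
    · rw [List.nodup_iff_count_le_one] at *
      intro v
      specialize hn v
      simp only [List.count_append, List.count_cons] at hn ⊢
      omega
    · simp [Set.insert_subset_iff]

theorem hasTheta_or_stuck_of_chord (h : IsBag G a b p q d d' c c' s t)
    (ih : BagSolvable G (s.length + t.length)) (hr : r ∈ d)
    (hk : k ∈ c ∨ k ∈ c' ∨ k ∈ s ∨ k ∈ t) (hQ : Arc G r Q k)
    (hn : (a :: b :: p :: q :: (d ++ d' ++ c ++ c' ++ s ++ t ++ Q)).Nodup)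
    (h₁ : f₁ ∈ arcEdges a d b) (h₂ : f₂ ∈ arcEdges a d' b) (h₃ : f₃ ∈ arcEdges p c q)
    (h₄ : f₄ ∈ arcEdges p c' q) (h₅ : f₅ ∈ arcEdges a s p) :
    HasTheta G {f₁, f₂, f₃, f₄, f₅} ∨ ∃ s₁ s₂ u₁ u₂, s = s₁ ++ k :: s₂ ∧ f₅ ∈ arcEdges a s₁ k ∧
      d = u₁ ++ r :: u₂ ∧ f₁ ∈ arcEdges a u₁ r := by
  classical
  rcases hk with hk | hk | hk | hk
  · refine Or.inl (hasTheta_of_prism h hr hk hQ hn h₁ h₂ h₃ h₄ ?_)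
    simp only [Set.mem_union]
    tauto
  · refine Or.inl ((hasTheta_of_prism (f₅ := f₅) h.swap_c hr hk hQ ?_ h₁ h₂ h₄ h₃ ?_).mono ?_)
    · rw [List.nodup_iff_count_le_one] at *
      intro v
      specialize hn v
      simp only [List.count_append, List.count_cons] at hn ⊢
      omega
    · simp only [Set.mem_union]
      tauto
    · simp [Set.insert_subset_iff]
  · exact hasTheta_or_stuck_of_land_s h ih hr hk hQ hn h₁ h₂ h₃ h₄ h₅
  · exact Or.inl (hasTheta_of_land_t h ih hr hk hQ hn h₁ h₂ h₃ h₄ (Or.inr h₅))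

theorem hasTheta_or_stuck (hreg : ∀ v : V, (G.neighborSet v).encard = 3) (hG : KConnected G 3)
    (h : IsBag G a b p q d d' c c' s t) (ih : BagSolvable G (s.length + t.length))
    (h₁ : f₁ ∈ arcEdges a d b) (h₂ : f₂ ∈ arcEdges a d' b) (h₃ : f₃ ∈ arcEdges p c q)
    (h₄ : f₄ ∈ arcEdges p c' q) (h₅ : f₅ ∈ arcEdges a s p) :
    HasTheta G {f₁, f₂, f₃, f₄, f₅} ∨ ∃ r k Q s₁ s₂, Arc G r Q k ∧
      (a :: b :: p :: q :: (d ++ d' ++ c ++ c' ++ s ++ t ++ Q)).Nodup ∧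
      s = s₁ ++ k :: s₂ ∧ f₅ ∈ arcEdges a s₁ k ∧
      ((∃ u₁ u₂, d = u₁ ++ r :: u₂ ∧ f₁ ∈ arcEdges a u₁ r) ∨
        ∃ u₁ u₂, d' = u₁ ++ r :: u₂ ∧ f₂ ∈ arcEdges a u₁ r) := by
  classical
  obtain ⟨r, k, Q, hr | hr, hk, hQ, hn⟩ := h.exists_chord hreg hG
  · rcases hasTheta_or_stuck_of_chord h ih hr hk hQ hn h₁ h₂ h₃ h₄ h₅ with
      h | ⟨s₁, s₂, u₁, u₂, hs, h₅, hd, h₁⟩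
    · exact Or.inl h
    · exact Or.inr ⟨r, k, Q, s₁, s₂, hQ, hn, hs, h₅, Or.inl ⟨u₁, u₂, hd, h₁⟩⟩
  · have hn' : (a :: b :: p :: q :: (d' ++ d ++ c ++ c' ++ s ++ t ++ Q)).Nodup := by
      rw [List.nodup_iff_count_le_one] at *
      intro v
      specialize hn v
      simp only [List.count_append, List.count_cons] at hn ⊢
      omega
    rcases hasTheta_or_stuck_of_chord h.swap_d ih hr hk hQ hn' h₂ h₁ h₃ h₄ h₅ with
      h | ⟨s₁, s₂, u₁, u₂, hs, h₅, hd, h₂⟩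
    · exact Or.inl (h.mono (by simp [Set.insert_subset_iff]))
    · exact Or.inr ⟨r, k, Q, s₁, s₂, hQ, hn, hs, h₅, Or.inr ⟨u₁, u₂, hd, h₂⟩⟩

/-- Two arcs with an edge in common have two vertices in common. -/
theorem exists_common_vertices {u v u' v' : V} {l l' : List V} {e : Sym2 V} (h : e ∈ arcEdges u l v)
    (h' : e ∈ arcEdges u' l' v') (he : e ∈ G.edgeSet) :
    ∃ x y, x ≠ y ∧ x ∈ u :: (l ++ [v]) ∧ y ∈ u :: (l ++ [v]) ∧ x ∈ u' :: (l' ++ [v']) ∧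
      y ∈ u' :: (l' ++ [v']) := by
  induction e using Sym2.ind with
  | _ x y =>
    exact ⟨x, y, he.ne, (mem_of_mem_listEdges h).1, (mem_of_mem_listEdges h).2,
      (mem_of_mem_listEdges h').1, (mem_of_mem_listEdges h').2⟩

theorem exists_interlaced {g : V} {s₁ s₂ t₁ t₂ : List V} {e : Sym2 V}
    (h : s₁ ++ k :: s₂ = t₁ ++ g :: t₂) (hn : (a :: p :: (s₁ ++ k :: s₂)).Nodup)
    (h₁ : e ∈ arcEdges a s₁ k) (h₂ : e ∈ arcEdges g t₂ p) (he : e ∈ G.edgeSet) :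
    ∃ m, s₁ = t₁ ++ g :: m ∧ e ∈ arcEdges g m k := by
  classical
  rw [List.nodup_iff_count_le_one] at hn
  have key : ¬ ∃ l, t₁ = s₁ ++ l ∧ k :: s₂ = l ++ g :: t₂ := by
    rintro ⟨l, rfl, hl⟩
    obtain ⟨x, y, hxy, hx, hy, hx', hy'⟩ := exists_common_vertices h₁ h₂ he
    have hg : (g :: (t₂ ++ [p])).Sublist (k :: (s₂ ++ [p])) := by
      rw [← List.cons_append, ← List.cons_append, hl, List.append_assoc]
      exact List.sublist_append_right _ _
    have hk : ∀ z, z ∈ a :: (s₁ ++ [k]) → z ∈ g :: (t₂ ++ [p]) → z = k := by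
      intro z hz hz'
      have hz' := hg.subset hz'
      specialize hn z
      rw [← List.count_pos_iff] at hz hz'
      simp only [List.count_append, List.count_cons, List.count_nil] at hn hz hz'
      by_contra hzk
      have : (k == z) = false := by simpa using Ne.symm hzk
      simp only [this, Bool.false_eq_true, if_false] at hn hz hz'
      omega
    exact hxy ((hk x hx hx').trans (hk y hy hy').symm)
  rcases List.append_eq_append_iff.1 h with hl | ⟨l, hl, hl'⟩
  · exact absurd hl key
  · cases l with
    | nil => exact absurd ⟨[], by simpa using hl.symm, by simpa using hl'.symm⟩ key
    | cons z m =>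
      obtain ⟨rfl, rfl⟩ := List.cons.inj (by simpa using hl')
      subst hl
      refine ⟨m, rfl, ?_⟩
      rw [arcEdges_append] at h₁ h₂
      rcases h₁ with h₁ | h₁
      · rcases h₂ with h₂ | h₂
        · exact h₂
        · obtain ⟨x, y, hxy, hx, hy, hx', hy'⟩ := exists_common_vertices h₁ h₂ he
          have := hn x
          rw [← List.count_pos_iff] at hx hx'
          simp only [List.count_append, List.count_cons, List.count_nil] at this hx hx'
          omega
      · exact h₁

end

section

variable {G : SimpleGraph V} {a b p q r k j g : V}
  {d d' c c' s t u₁ u₂ w₁ w₂ s₁ s₂ t₁ t₂ Q R : List V} {f₁ f₂ f₃ f₄ f₅ : Sym2 V}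

theorem hasTheta_of_stuck (h : IsBag G a b p q (u₁ ++ r :: u₂) d' (w₁ ++ j :: w₂) c' s t)
    (hQ : Arc G r Q k) (hR : Arc G j R g)
    (hQn : (a :: b :: p :: q :: (u₁ ++ r :: u₂ ++ d' ++ (w₁ ++ j :: w₂) ++ c' ++ s ++ t ++ Q)).Nodup)
    (hRn : (a :: b :: p :: q :: (u₁ ++ r :: u₂ ++ d' ++ (w₁ ++ j :: w₂) ++ c' ++ s ++ t ++ R)).Nodup)
    (hs : s = s₁ ++ k :: s₂) (hs' : s.reverse = t₁ ++ g :: t₂)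
    (h₁ : f₁ ∈ arcEdges a u₁ r) (h₂ : f₂ ∈ arcEdges a d' b) (h₃ : f₃ ∈ arcEdges p w₁ j)
    (h₄ : f₄ ∈ arcEdges p c' q) (h₅ : f₅ ∈ arcEdges a s₁ k) (h₅' : f₅ ∈ arcEdges p t₁ g) :
    HasTheta G {f₁, f₂, f₃, f₄, f₅} := by
  classical
  rw [List.nodup_iff_count_le_one] at hQn hRn
  have hs'' : s = t₂.reverse ++ g :: t₁.reverse := by
    rw [← List.reverse_reverse s, hs']
    simp
  by_cases hz : ∃ z ∈ Q, z ∈ R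
  · obtain ⟨z, hzQ, hzR⟩ := hz
    obtain ⟨Q₁, z, hzR, Q₂, rfl, hQ₁⟩ := exists_first_mem (A := {x | x ∈ R}) hzQ hzR
    obtain ⟨R₁, R₂, rfl⟩ := List.append_of_mem hzR
    rw [arc_append] at hQ hR
    refine hasTheta_of_prism (r := r) (k := j) (Q := Q₁ ++ z :: R₁.reverse) h (by simp) (by simp)
      (arc_append.2 ⟨hQ.1, arc_reverse.2 hR.1⟩) ?_ ?_ h₂ ?_ h₄ ?_
    · rw [List.nodup_iff_count_le_one]
      intro v
      specialize hQn v
      specialize hRn v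
      have : List.count v Q₁ = 0 ∨ List.count v R₁ = 0 := by
        by_cases hv : v ∈ Q₁
        · right
          rw [List.count_eq_zero]
          exact fun hv' => hQ₁ v hv (by simp [hv'])
        · exact Or.inl (List.count_eq_zero.2 hv)
      simp only [List.count_append, List.count_cons, List.count_reverse] at hQn hRn ⊢
      omega
    · rw [arcEdges_append]
      exact Or.inl h₁
    · rw [arcEdges_append]
      exact Or.inl h₃
    · refine Or.inl (Or.inr ?_)
      rw [hs, arcEdges_append]
      exact Or.inl h₅
  · obtain ⟨m, rfl, hm⟩ := exists_interlaced (a := a) (p := p) (hs.symm.trans hs'')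
      (by
        rw [← hs, List.nodup_iff_count_le_one]
        intro v
        specialize hQn v
        simp only [List.count_append, List.count_cons] at hQn ⊢
        omega)
      h₅ (by rwa [arcEdges_reverse])
      (by
        have := h.arc_s
        rw [hs, arc_append] at this
        exact this.1.edges_subset h₅)
    rw [List.append_assoc, List.cons_append] at hs
    subst hs
    refine (hasTheta_of_two_chords h hQ hR ?_).mono ?_
    · rw [List.nodup_iff_count_le_one]
      intro v
      specialize hQn v
      specialize hRn v
      have : List.count v Q = 0 ∨ List.count v R = 0 := by
        by_cases hv : v ∈ Q
        · right
          rw [List.count_eq_zero]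
          exact fun hv' => hz ⟨v, hv, hv'⟩
        · exact Or.inl (List.count_eq_zero.2 hv)
      simp only [List.count_append, List.count_cons] at hQn hRn ⊢
      omega
    · simp only [Set.insert_subset_iff, Set.singleton_subset_iff, Set.mem_union]
      tauto

theorem hasTheta_of_label_s (hreg : ∀ v : V, (G.neighborSet v).encard = 3) (hG : KConnected G 3)
    (h : IsBag G a b p q d d' c c' s t) (ih : BagSolvable G (s.length + t.length))
    (h₁ : f₁ ∈ arcEdges a d b) (h₂ : f₂ ∈ arcEdges a d' b) (h₃ : f₃ ∈ arcEdges p c q)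
    (h₄ : f₄ ∈ arcEdges p c' q) (h₅ : f₅ ∈ arcEdges a s p) :
    HasTheta G {f₁, f₂, f₃, f₄, f₅} := by
  classical
  rcases hasTheta_or_stuck hreg hG h ih h₁ h₂ h₃ h₄ h₅ with
    hT | ⟨r, k, Q, s₁, s₂, hQ, hQn, hs, hs₁, hd⟩
  · exact hT
  rcases hasTheta_or_stuck (f₅ := f₅) hreg hG h.mirror (by simpa using ih) h₃ h₄ h₁ h₂
    (by rwa [arcEdges_reverse]) with hT | ⟨j, g, R, t₁, t₂, hR, hRn, ht, ht₁, hc⟩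
  · exact hT.mono (by simp [Set.insert_subset_iff])
  rw [List.nodup_iff_count_le_one] at hQn hRn
  rcases hd with ⟨u₁, u₂, rfl, hu⟩ | ⟨u₁, u₂, rfl, hu⟩ <;>
    rcases hc with ⟨w₁, w₂, rfl, hw⟩ | ⟨w₁, w₂, rfl, hw⟩
  · refine hasTheta_of_stuck h hQ hR ?_ ?_ hs ht hu h₂ hw h₄ hs₁ ht₁
    all_goals
      rw [List.nodup_iff_count_le_one]
      intro v
      specialize hQn v
      specialize hRn v
      simp only [List.count_append, List.count_cons, List.count_reverse] at hQn hRn ⊢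
      omega
  · refine (hasTheta_of_stuck h.swap_c hQ hR ?_ ?_ hs ht hu h₂ hw h₃ hs₁ ht₁).mono
      (by simp [Set.insert_subset_iff])
    all_goals
      rw [List.nodup_iff_count_le_one]
      intro v
      specialize hQn v
      specialize hRn v
      simp only [List.count_append, List.count_cons, List.count_reverse] at hQn hRn ⊢
      omega
  · refine (hasTheta_of_stuck h.swap_d hQ hR ?_ ?_ hs ht hu h₁ hw h₄ hs₁ ht₁).mono
      (by simp [Set.insert_subset_iff])
    all_goals
      rw [List.nodup_iff_count_le_one]
      intro v
      specialize hQn v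
      specialize hRn v
      simp only [List.count_append, List.count_cons, List.count_reverse] at hQn hRn ⊢
      omega
  · refine (hasTheta_of_stuck h.swap_d.swap_c hQ hR ?_ ?_ hs ht hu h₁ hw h₃ hs₁ ht₁).mono
      (by simp [Set.insert_subset_iff])
    all_goals
      rw [List.nodup_iff_count_le_one]
      intro v
      specialize hQn v
      specialize hRn v
      simp only [List.count_append, List.count_cons, List.count_reverse] at hQn hRn ⊢
      omega

theorem bagSolvable (hreg : ∀ v : V, (G.neighborSet v).encard = 3) (hG : KConnected G 3) (n : ℕ) :
    BagSolvable G n := by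
  induction n using Nat.strong_induction_on with
  | _ n ih =>
    intro a b p q d d' c c' s t h hlt f₁ f₂ f₃ f₄ f₅ h₁ h₂ h₃ h₄ h₅
    specialize ih _ hlt
    have hm : f₅ ∈ arcEdges a d b ∪ arcEdges a d' b → HasTheta G {f₁, f₂, f₃, f₄, f₅} := fun h₅ =>
      (hasTheta_of_label_c hreg hG h.mirror (by simpa using ih) h₃ h₄ h₁ h₂ h₅).mono
        (by simp [Set.insert_subset_iff])
    rcases h₅ with ((((h₅ | h₅) | h₅) | h₅) | h₅) | h₅
    · exact hm (Or.inl h₅)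
    · exact hm (Or.inr h₅)
    · exact hasTheta_of_label_c hreg hG h ih h₁ h₂ h₃ h₄ (Or.inl h₅)
    · exact hasTheta_of_label_c hreg hG h ih h₁ h₂ h₃ h₄ (Or.inr h₅)
    · exact hasTheta_of_label_s hreg hG h ih h₁ h₂ h₃ h₄ h₅
    · exact hasTheta_of_label_s hreg hG h.flip (by rwa [Nat.add_comm]) (by rwa [arcEdges_reverse])
        (by rwa [arcEdges_reverse]) (by rwa [arcEdges_reverse]) (by rwa [arcEdges_reverse]) h₅

end

section

variable {G : SimpleGraph V} {a b u v : V} {l₁ l₂ l₃ x₁ y₁ x₂ y₂ m P : List V}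

/-- Every edge of a cubic 3-connected graph lies on a θ-graph. -/
theorem hasTheta_singleton (hreg : ∀ v : V, (G.neighborSet v).encard = 3) (hG : KConnected G 3)
    {e : Sym2 V} (he : e ∈ G.edgeSet) : HasTheta G {e} := by
  classical
  induction e using Sym2.ind with
  | _ v w =>
  obtain ⟨w₁, w₂, w₃, h₁₂, h₁₃, h₂₃, hN⟩ := Set.encard_eq_three.1 (hreg v)
  have hadj : ∀ z, G.Adj v z ↔ z = w₁ ∨ z = w₂ ∨ z = w₃ := fun z => by
    rw [← SimpleGraph.mem_neighborSet, hN]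
    simp
  have hw₁ := (hadj w₁).2 (by simp)
  have hw₂ := (hadj w₂).2 (by simp)
  have hw₃ := (hadj w₃).2 (by simp)
  have hv : (G.induce {v}ᶜ).Connected := hG {v} (by simp)
  obtain ⟨_, rfl, _, rfl, l, hl, hln, hl'⟩ := exists_bridge hv (A := {w₁}) (B := {w₂})
    (by simpa using h₁₂) (by simpa using hw₁.ne') (by simpa using hw₂.ne') ⟨w₁, rfl⟩ ⟨w₂, rfl⟩
  rename_i w₁ w₂
  have hcyc : Arc G v (w₁ :: (l ++ [w₂])) v := by
    have : Arc G v ([] ++ w₁ :: (l ++ w₂ :: [])) v := by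
      rw [arc_append, arc_append]
      exact ⟨by simpa [Arc] using hw₁, hl, by simpa [Arc] using hw₂.symm⟩
    simpa using this
  have hcn : (v :: w₁ :: (l ++ [w₂])).Nodup := by
    rw [List.nodup_iff_count_le_one] at *
    intro z
    specialize hln z
    by_cases hz : z ∈ l
    · have := hl' z hz
      simp only [Set.mem_singleton_iff] at this
      have h₁ : (w₁ == z) = false := by simpa using fun h => this.1 h.symm
      have h₂ : (w₂ == z) = false := by simpa using fun h => this.2.1 h.symm
      have h₃ : (v == z) = false := by simpa using fun h => this.2.2 h.symm
      simp [List.count_append, List.count_cons, h₁, h₂, h₃, hln]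
    · rw [← List.count_eq_zero] at hz
      have h₁ := hw₁.ne
      have h₂ := hw₂.ne
      simp only [List.count_append, List.count_cons, hz, beq_iff_eq, List.count_nil]
      split_ifs <;> simp_all
  obtain ⟨y, N, hy, hNa, hNe, hNn, hN₀⟩ : ∃ y N, y ∈ w₁ :: (l ++ [w₂]) ∧ Arc G v N y ∧
      s(v, w₃) ∈ arcEdges v N y ∧ (v :: w₁ :: (l ++ [w₂]) ++ N).Nodup ∧ (N = [] → y = w₃) := by
    by_cases h₃ : w₃ ∈ w₁ :: (l ++ [w₂])
    · exact ⟨w₃, [], h₃, by simpa [Arc] using hw₃, by simp [arcEdges, listEdges],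
        by simpa using hcn, fun _ => rfl⟩
    · obtain ⟨w', hw', y, hy, N, hN, hNn, hN'⟩ := exists_bridge hv (A := {w₃})
        (B := {x | x ∈ w₁ :: (l ++ [w₂])}) (by simpa using h₃) (by simpa using hw₃.ne')
        (by simpa using (List.nodup_cons.1 hcn).1) ⟨w₃, rfl⟩ ⟨w₁, by simp⟩
      rw [Set.mem_singleton_iff] at hw'
      subst w'
      refine ⟨y, w₃ :: N, hy, ?_, by simp [arcEdges, listEdges], ?_, by simp⟩
      · exact (arc_append (l₁ := [])).2 ⟨by simpa [Arc] using hw₃, hN⟩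
      · rw [List.nodup_append]
        refine ⟨hcn, ?_, ?_⟩
        · rw [List.nodup_cons]
          exact ⟨fun h => (hN' _ h).1 rfl, hNn⟩
        · rintro z hz _ hz' rfl
          rcases List.mem_cons.1 hz' with rfl | hz'
          · rcases List.mem_cons.1 hz with rfl | hz
            exacts [hw₃.ne rfl, h₃ hz]
          · rcases List.mem_cons.1 hz with rfl | hz
            exacts [(hN' _ hz').2.2 rfl, (hN' _ hz').2.1 hz]
  obtain ⟨L₁, L₂, hL⟩ := List.append_of_mem hy
  have hew : s(v, w₁) ∈ arcEdges v (w₁ :: (l ++ [w₂])) v := by simp [arcEdges, listEdges]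
  have hew' : s(v, w₂) ∈ arcEdges v (w₁ :: (l ++ [w₂])) v := by
    rw [← arcEdges_reverse]
    simp [arcEdges, listEdges]
  have hL₁ : L₁ = [] → y = w₁ := by
    rintro rfl
    simp only [List.nil_append, List.cons.injEq] at hL
    exact hL.1.symm
  have hL₂ : L₂ = [] → y = w₂ := by
    rintro rfl
    have := congrArg List.getLast? hL
    simpa [List.getLast?_cons] using this.symm
  rw [hL] at hcyc hNn hew hew'
  rw [arc_append] at hcyc
  rw [arcEdges_append] at hew hew'
  refine ⟨v, y, L₁, L₂.reverse, N, ⟨hcyc.1, arc_reverse.2 hcyc.2, hNa, ?_, ?_, ?_, ?_⟩, ?_⟩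
  · rw [List.nodup_iff_count_le_one] at *
    intro z
    specialize hNn z
    simp only [List.count_append, List.count_cons, List.count_reverse] at hNn ⊢
    omega
  · by_contra! h
    exact h₁₂ ((hL₁ h.1).symm.trans (hL₂ (by simpa using h.2)))
  · by_contra! h
    exact h₁₃ ((hL₁ h.1).symm.trans (hN₀ h.2))
  · by_contra! h
    exact h₂₃ ((hL₂ (by simpa using h.1)).symm.trans (hN₀ h.2))
  · rw [arcEdges_reverse, Set.singleton_subset_iff]
    rcases (hadj w).1 he with rfl | rfl | rfl
    exacts [Or.inl hew, Or.inl hew', Or.inr hNe]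

theorem range_subset_of_five {α : Type*} {f : Fin 4 → α} {A B C D E : Set α}
    (h : Set.range f ⊆ A ∪ B ∪ C ∪ D ∪ E) :
    Set.range f ⊆ B ∪ C ∪ D ∪ E ∨ Set.range f ⊆ A ∪ C ∪ D ∪ E ∨ Set.range f ⊆ A ∪ B ∪ D ∪ E ∨
      Set.range f ⊆ A ∪ B ∪ C ∪ E ∨ Set.range f ⊆ A ∪ B ∪ C ∪ D := by
  have h' : ∀ i, ∃ j : Fin 5, f i ∈ ![A, B, C, D, E] j := fun i => by
    rcases h ⟨i, rfl⟩ with (((h | h) | h) | h) | h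
    exacts [⟨0, h⟩, ⟨1, h⟩, ⟨2, h⟩, ⟨3, h⟩, ⟨4, h⟩]
  choose g hg using h'
  obtain ⟨j, hj⟩ : ∃ j, ∀ i, g i ≠ j := by
    by_contra! H
    have := Fintype.card_le_of_surjective g H
    simp at this
  simp only [Set.range_subset_iff, Set.mem_union]
  have key : ∀ i, (j ≠ 0 ∧ f i ∈ A) ∨ (j ≠ 1 ∧ f i ∈ B) ∨ (j ≠ 2 ∧ f i ∈ C) ∨
      (j ≠ 3 ∧ f i ∈ D) ∨ (j ≠ 4 ∧ f i ∈ E) := fun i => by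
    have h₁ := hg i
    have h₂ := hj i
    generalize g i = k at h₁ h₂
    fin_cases k <;> simp at h₁ h₂ <;> simp [h₁, Ne.symm h₂]
  fin_cases j <;> simp at key <;> grind

theorem range_subset_or_labels {α : Type*} {f : Fin 4 → α} {A B C D E : Set α}
    (h : Set.range f ⊆ A ∪ B ∪ C ∪ D ∪ E) :
    Set.range f ⊆ B ∪ C ∪ D ∪ E ∨ Set.range f ⊆ A ∪ C ∪ D ∪ E ∨ Set.range f ⊆ A ∪ B ∪ D ∪ E ∨
      ∃ i j k l, f i ∈ A ∧ f j ∈ B ∧ f k ∈ C ∧ Set.range f ⊆ {f i, f j, f k, f l} := by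
  have h' : ∀ i, ∃ j : Fin 5, f i ∈ ![A, B, C, D, E] j := fun i => by
    rcases h ⟨i, rfl⟩ with (((h | h) | h) | h) | h
    exacts [⟨0, h⟩, ⟨1, h⟩, ⟨2, h⟩, ⟨3, h⟩, ⟨4, h⟩]
  choose g hg using h'
  by_cases hs : ∃ i j k, g i = 0 ∧ g j = 1 ∧ g k = 2
  · obtain ⟨i, j, k, hi, hj, hk⟩ := hs
    have hij : i ≠ j := by rintro rfl; simp [hi] at hj
    have hik : i ≠ k := by rintro rfl; simp [hi] at hk
    have hjk : j ≠ k := by rintro rfl; simp [hj] at hk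
    obtain ⟨l, hl⟩ : ∃ l, ∀ m, m = i ∨ m = j ∨ m = k ∨ m = l := by
      clear * - hij hik hjk
      revert i j k
      decide
    refine Or.inr (Or.inr (Or.inr ⟨i, j, k, l, ?_, ?_, ?_, ?_⟩))
    · simpa [hi] using hg i
    · simpa [hj] using hg j
    · simpa [hk] using hg k
    · rintro _ ⟨m, rfl⟩
      rcases hl m with rfl | rfl | rfl | rfl <;> simp
  · obtain ⟨j, hj, hj3⟩ : ∃ j, (∀ i, g i ≠ j) ∧ (j = 0 ∨ j = 1 ∨ j = 2) := by
      by_contra! H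
      obtain ⟨i, hi⟩ : ∃ i, g i = 0 := by
        by_contra! h
        exact (H 0 h).1 rfl
      obtain ⟨j, hj⟩ : ∃ i, g i = 1 := by
        by_contra! h
        exact (H 1 h).2.1 rfl
      obtain ⟨k, hk⟩ : ∃ i, g i = 2 := by
        by_contra! h
        exact (H 2 h).2.2 rfl
      exact hs ⟨i, j, k, hi, hj, hk⟩
    simp only [Set.range_subset_iff, Set.mem_union]
    have key : ∀ i, (j ≠ 0 ∧ f i ∈ A) ∨ (j ≠ 1 ∧ f i ∈ B) ∨ (j ≠ 2 ∧ f i ∈ C) ∨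
        f i ∈ D ∨ f i ∈ E := fun i => by
      have h₁ := hg i
      have h₂ := hj i
      generalize g i = k at h₁ h₂
      fin_cases k <;> simp at h₁ h₂ <;> simp [h₁, Ne.symm h₂]
    rcases hj3 with rfl | rfl | rfl <;> simp at key <;> grind

/-- An ear joining two different arcs of a θ-graph: among the arcs of the resulting subdivision of
`K₄`, four labelled edges leave out one which can be deleted. -/
theorem hasTheta_of_ear_of_ne {f : Fin 4 → Sym2 V} {e : Sym2 V}
    (h : IsTheta G a b l₁ l₂ l₃) (hu : u ∈ l₁) (hv : v ∈ l₂) (hP : Arc G u P v)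
    (hn : (a :: b :: (l₁ ++ l₂ ++ l₃ ++ P)).Nodup)
    (hf : Set.range f ⊆ arcEdges a l₁ b ∪ arcEdges a l₂ b ∪ arcEdges a l₃ b)
    (he : e ∈ arcEdges u P v) : HasTheta G (insert e (Set.range f)) := by
  classical
  obtain ⟨x₁, y₁, rfl⟩ := List.append_of_mem hu
  obtain ⟨x₂, y₂, rfl⟩ := List.append_of_mem hv
  obtain ⟨h₁, h₂, h₃, -, -, -, -⟩ := h
  rw [arc_append] at h₁ h₂
  rw [List.nodup_iff_count_le_one] at hn
  have hf' : Set.range f ⊆ arcEdges a x₁ u ∪ arcEdges u y₁ b ∪ arcEdges a x₂ v ∪ arcEdges v y₂ b ∪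
      arcEdges a l₃ b := by
    simpa only [arcEdges_append, Set.union_assoc] using hf
  rcases range_subset_of_five hf' with hf | hf | hf | hf | hf
  · refine ⟨v, b, y₂, x₂.reverse ++ a :: l₃, P.reverse ++ u :: y₁,
      ⟨?_, ?_, ?_, ?_, by simp, by simp, by simp⟩, ?_⟩
    case refine_4 =>
      rw [List.nodup_iff_count_le_one]
      intro z
      specialize hn z
      simp only [List.count_append, List.count_cons, List.count_reverse] at hn ⊢
      omega
    case refine_5 =>
      refine Set.insert_subset ?_ (hf.trans ?_)
      · simp [arcEdges_append, arcEdges_reverse, he]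
      · intro z
        simp only [arcEdges_append, arcEdges_reverse, Set.mem_union]
        tauto
    all_goals
      try simp only [arc_append, arc_reverse]
      tauto
  · refine ⟨a, v, x₂, l₃ ++ b :: y₂.reverse, x₁ ++ u :: P,
      ⟨?_, ?_, ?_, ?_, by simp, by simp, by simp⟩, ?_⟩
    case refine_4 =>
      rw [List.nodup_iff_count_le_one]
      intro z
      specialize hn z
      simp only [List.count_append, List.count_cons, List.count_reverse] at hn ⊢
      omega
    case refine_5 =>
      refine Set.insert_subset ?_ (hf.trans ?_)
      · simp [arcEdges_append, he]
      · intro z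
        simp only [arcEdges_append, arcEdges_reverse, Set.mem_union]
        tauto
    all_goals
      try simp only [arc_append, arc_reverse]
      tauto
  · refine ⟨u, b, y₁, x₁.reverse ++ a :: l₃, P ++ v :: y₂,
      ⟨?_, ?_, ?_, ?_, by simp, by simp, by simp⟩, ?_⟩
    case refine_4 =>
      rw [List.nodup_iff_count_le_one]
      intro z
      specialize hn z
      simp only [List.count_append, List.count_cons, List.count_reverse] at hn ⊢
      omega
    case refine_5 =>
      refine Set.insert_subset ?_ (hf.trans ?_)
      · simp [arcEdges_append, he]
      · intro z
        simp only [arcEdges_append, arcEdges_reverse, Set.mem_union]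
        tauto
    all_goals
      try simp only [arc_append, arc_reverse]
      tauto
  · refine ⟨a, u, x₁, l₃ ++ b :: y₁.reverse, x₂ ++ v :: P.reverse,
      ⟨?_, ?_, ?_, ?_, by simp, by simp, by simp⟩, ?_⟩
    case refine_4 =>
      rw [List.nodup_iff_count_le_one]
      intro z
      specialize hn z
      simp only [List.count_append, List.count_cons, List.count_reverse] at hn ⊢
      omega
    case refine_5 =>
      refine Set.insert_subset ?_ (hf.trans ?_)
      · simp [arcEdges_append, arcEdges_reverse, he]
      · intro z
        simp only [arcEdges_append, arcEdges_reverse, Set.mem_union]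
        tauto
    all_goals
      try simp only [arc_append, arc_reverse]
      tauto
  · refine ⟨u, v, x₁.reverse ++ a :: x₂, y₁ ++ b :: y₂.reverse, P,
      ⟨?_, ?_, ?_, ?_, by simp, by simp, by simp⟩, ?_⟩
    case refine_4 =>
      rw [List.nodup_iff_count_le_one]
      intro z
      specialize hn z
      simp only [List.count_append, List.count_cons, List.count_reverse] at hn ⊢
      omega
    case refine_5 =>
      refine Set.insert_subset (by simp [he]) (hf.trans ?_)
      · intro z
        simp only [arcEdges_append, arcEdges_reverse, Set.mem_union]
        tauto
    all_goals
      try simp only [arc_append, arc_reverse]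
      tauto

/-- An ear joining two vertices of the same arc of a θ-graph. -/
theorem hasTheta_of_ear_of_eq (hreg : ∀ v : V, (G.neighborSet v).encard = 3) (hG : KConnected G 3)
    {f : Fin 4 → Sym2 V} {e : Sym2 V}
    (h : IsTheta G a b (x₁ ++ u :: (m ++ v :: y₁)) l₂ l₃) (hP : Arc G u P v)
    (hn : (a :: b :: (x₁ ++ u :: (m ++ v :: y₁) ++ l₂ ++ l₃ ++ P)).Nodup)
    (hf : Set.range f ⊆ arcEdges a (x₁ ++ u :: (m ++ v :: y₁)) b ∪ arcEdges a l₂ b ∪ arcEdges a l₃ b)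
    (he : e ∈ arcEdges u P v) (hm : m ≠ [] ∨ P ≠ []) : HasTheta G (insert e (Set.range f)) := by
  classical
  obtain ⟨h₁, h₂, h₃, -, -, -, hne⟩ := h
  rw [arc_append, arc_append] at h₁
  have hB : IsBag G a b u v l₂ l₃ m P x₁ y₁.reverse := by
    refine ⟨h₂, h₃, h₁.2.1, hP, h₁.1, arc_reverse.2 h₁.2.2, ?_, hne, hm⟩
    rw [List.nodup_iff_count_le_one] at *
    intro z
    specialize hn z
    simp only [List.count_append, List.count_cons, List.count_reverse] at hn ⊢
    omega
  have hf' : Set.range f ⊆ arcEdges a l₂ b ∪ arcEdges a l₃ b ∪ arcEdges u m v ∪ arcEdges a x₁ u ∪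
      arcEdges v y₁ b := by
    refine hf.trans fun z => ?_
    simp only [arcEdges_append, Set.mem_union]
    tauto
  rcases range_subset_or_labels hf' with hf | hf | hf | ⟨i, j, k, l, hi, hj, hk, hl⟩
  · refine hB.hasTheta_delete_d.mono (Set.insert_subset (by simp [he]) (hf.trans fun z => ?_))
    simp only [arcEdges_reverse, Set.mem_union]
    tauto
  · refine hB.swap_d.hasTheta_delete_d.mono
      (Set.insert_subset (by simp [he]) (hf.trans fun z => ?_))
    simp only [arcEdges_reverse, Set.mem_union]
    tauto
  · refine hB.mirror.hasTheta_delete_d.mono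
      (Set.insert_subset (by simp [he]) (hf.trans fun z => ?_))
    simp only [arcEdges_reverse, Set.mem_union]
    tauto
  · refine (bagSolvable hreg hG _ hB (Nat.lt_succ_self _) (f₅ := f l) hi hj hk he ?_).mono
      (Set.insert_subset (by simp) (hl.trans ?_))
    · have := hf' ⟨l, rfl⟩
      simp only [arcEdges_reverse, Set.mem_union] at this ⊢
      tauto
    · simp [Set.insert_subset_iff]

end

section

variable {G : SimpleGraph V} {a b u v : V} {l₁ l₂ l₃ P : List V}

theorem IsTheta.mem_arcEdges_of_adj (hreg : ∀ v : V, (G.neighborSet v).encard = 3)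
    (h : IsTheta G a b l₁ l₂ l₃) {x : V} (hx : G.Adj a x) :
    s(a, x) ∈ arcEdges a l₁ b ∪ arcEdges a l₂ b ∪ arcEdges a l₃ b := by
  have hn := h.nodup
  refine adj_of_three_arcs hreg h.arc₁ h.arc₂ h.arc₃ ?_ ?_ ?_ hx
  · exact heads_disjoint (hn.sublist (by grind)) (hn.sublist (by grind)) fun _ => h.ne₁₂
  · exact heads_disjoint (hn.sublist (by grind)) (hn.sublist (by grind)) fun _ => h.ne₁₃
  · exact heads_disjoint (hn.sublist (by grind)) (hn.sublist (by grind)) fun _ => h.ne₂₃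

theorem IsTheta.arcEdges_subset_of_left (hreg : ∀ v : V, (G.neighborSet v).encard = 3)
    (h : IsTheta G a b l₁ l₂ l₃) (hP : Arc G a P v) (hP' : ∀ z ∈ P, z ∉ l₁ ++ l₂ ++ l₃ ∧ z ≠ b)
    (hPa : a ∉ P) :
    arcEdges a P v ⊆ arcEdges a l₁ b ∪ arcEdges a l₂ b ∪ arcEdges a l₃ b := by
  obtain ⟨n, hn, -, hn'⟩ := hP.exists_head
  have he := h.mem_arcEdges_of_adj hreg hn
  rcases hn' with ⟨rfl, rfl⟩ | hn'
  · simpa [arcEdges, listEdges] using he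
  · have hm : n ∈ a :: b :: (l₁ ++ l₂ ++ l₃) := by
      rcases he with (he | he) | he <;> have := (mem_of_mem_listEdges he).2 <;> grind
    have := hP' n hn'
    grind

theorem IsTheta.ear_ne (hreg : ∀ v : V, (G.neighborSet v).encard = 3)
    (h : IsTheta G a b l₁ l₂ l₃) (hP : Arc G u P v)
    (hP' : ∀ z ∈ P, z ∉ a :: b :: (l₁ ++ l₂ ++ l₃)) {e : Sym2 V} (he : e ∈ arcEdges u P v)
    (he' : e ∉ arcEdges a l₁ b ∪ arcEdges a l₂ b ∪ arcEdges a l₃ b) : u ≠ a ∧ u ≠ b := by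
  refine ⟨?_, ?_⟩
  · rintro rfl
    exact he' (h.arcEdges_subset_of_left hreg hP (fun z hz => by have := hP' z hz; grind)
      (fun hz => by have := hP' _ hz; grind) he)
  · rintro rfl
    have := h.flip.arcEdges_subset_of_left hreg hP (fun z hz => by have := hP' z hz; grind)
      (fun hz => by have := hP' _ hz; grind) he
    simp only [arcEdges_reverse] at this
    exact he' this

theorem hasTheta_of_ear_same (hreg : ∀ v : V, (G.neighborSet v).encard = 3) (hG : KConnected G 3)
    {f : Fin 4 → Sym2 V} {e : Sym2 V} (h : IsTheta G a b l₁ l₂ l₃)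
    (hu : u ∈ l₁) (hv : v ∈ l₁) (huv : u ≠ v) (hP : Arc G u P v)
    (hn : (a :: b :: (l₁ ++ l₂ ++ l₃ ++ P)).Nodup)
    (hf : Set.range f ⊆ arcEdges a l₁ b ∪ arcEdges a l₂ b ∪ arcEdges a l₃ b)
    (he : e ∈ arcEdges u P v)
    (he' : e ∉ arcEdges a l₁ b ∪ arcEdges a l₂ b ∪ arcEdges a l₃ b) :
    HasTheta G (insert e (Set.range f)) := by
  obtain ⟨x, y, rfl⟩ := List.append_of_mem hu
  rcases (by grind : v ∈ x ∨ v ∈ y) with hv | hv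
  · obtain ⟨x, m, rfl⟩ := List.append_of_mem hv
    simp only [List.append_assoc, List.cons_append] at h hf hn he'
    refine hasTheta_of_ear_of_eq hreg hG (x₁ := x) (m := m) (P := P.reverse) h
      (arc_reverse.2 hP) ?_ hf (by rwa [arcEdges_reverse]) ?_
    · refine (List.Perm.nodup_iff ?_).1 hn
      simp [List.perm_append_left_iff]
    · by_contra! hc
      obtain ⟨rfl, hc⟩ := hc
      obtain rfl := List.reverse_eq_nil_iff.1 hc
      refine he' ?_
      rw [← arcEdges_reverse] at he
      rw [arcEdges_append, arcEdges_append _ []]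
      exact Or.inl (Or.inl (Or.inr (Or.inl he)))
  · obtain ⟨m, y, rfl⟩ := List.append_of_mem hv
    refine hasTheta_of_ear_of_eq hreg hG h hP hn hf he ?_
    by_contra! hc
    obtain ⟨rfl, rfl⟩ := hc
    refine he' ?_
    rw [arcEdges_append, arcEdges_append _ []]
    exact Or.inl (Or.inl (Or.inr (Or.inl he)))

theorem hasTheta_of_ear_left (hreg : ∀ v : V, (G.neighborSet v).encard = 3) (hG : KConnected G 3)
    {f : Fin 4 → Sym2 V} {e : Sym2 V} (h : IsTheta G a b l₁ l₂ l₃)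
    (hu : u ∈ l₁) (hv : v ∈ l₁ ∨ v ∈ l₂ ∨ v ∈ l₃) (huv : u ≠ v) (hP : Arc G u P v)
    (hn : (a :: b :: (l₁ ++ l₂ ++ l₃ ++ P)).Nodup)
    (hf : Set.range f ⊆ arcEdges a l₁ b ∪ arcEdges a l₂ b ∪ arcEdges a l₃ b)
    (he : e ∈ arcEdges u P v)
    (he' : e ∉ arcEdges a l₁ b ∪ arcEdges a l₂ b ∪ arcEdges a l₃ b) :
    HasTheta G (insert e (Set.range f)) := by
  classical
  rcases hv with hv | hv | hv
  · exact hasTheta_of_ear_same hreg hG h hu hv huv hP hn hf he he'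
  · exact hasTheta_of_ear_of_ne h hu hv hP hn hf he
  · refine hasTheta_of_ear_of_ne h.swap₂₃ hu hv hP ?_ ?_ he
    · refine (List.Perm.nodup_iff ?_).1 hn
      grind
    · rwa [Set.union_right_comm]

theorem hasTheta_insert (hreg : ∀ v : V, (G.neighborSet v).encard = 3) (hG : KConnected G 3)
    {f : Fin 4 → Sym2 V} {e : Sym2 V} (hf : HasTheta G (Set.range f)) (he : e ∈ G.edgeSet) :
    HasTheta G (insert e (Set.range f)) := by
  classical
  obtain ⟨a, b, l₁, l₂, l₃, h, hf⟩ := hf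
  by_cases he' : e ∈ arcEdges a l₁ b ∪ arcEdges a l₂ b ∪ arcEdges a l₃ b
  · exact ⟨a, b, l₁, l₂, l₃, h, Set.insert_subset he' hf⟩
  induction e using Sym2.ind with
  | _ x y =>
  have hab : a ≠ b := by have := h.nodup; grind
  obtain ⟨u, hu, v, hv, P, hP, hPn, hP', heP⟩ := exists_ear hG
    (A := {x | x ∈ a :: b :: (l₁ ++ l₂ ++ l₃)}) ⟨a, by simp, b, by simp, hab⟩ he
  have hn : (a :: b :: (l₁ ++ l₂ ++ l₃ ++ P)).Nodup := by
    have : (a :: b :: (l₁ ++ l₂ ++ l₃) ++ P).Nodup := by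
      rw [List.nodup_append]
      refine ⟨h.nodup, hPn.sublist (by grind), ?_⟩
      rintro z hz _ hz' rfl
      exact hP' z hz' hz
    simpa using this
  have huv : u ≠ v := by grind
  have hua := h.ear_ne hreg hP hP' heP he'
  have hva := h.ear_ne hreg (arc_reverse.2 hP) (fun z hz => hP' z (by simpa using hz))
    (by rwa [arcEdges_reverse]) he'
  simp only [Set.mem_ofPred_eq] at hu hv
  have hu : u ∈ l₁ ∨ u ∈ l₂ ∨ u ∈ l₃ := by grind
  have hv : v ∈ l₁ ∨ v ∈ l₂ ∨ v ∈ l₃ := by grind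
  rcases hu with hu | hu | hu
  · exact hasTheta_of_ear_left hreg hG h hu hv huv hP hn hf heP he'
  · rw [Set.union_comm (arcEdges a l₁ b)] at hf he'
    refine hasTheta_of_ear_left hreg hG h.swap₁₂ hu (by tauto) huv hP ?_ hf heP he'
    refine (List.Perm.nodup_iff (List.perm_iff_count.2 fun z => ?_)).1 hn
    simp only [List.count_append, List.count_cons]
    omega
  · rw [Set.union_right_comm, Set.union_comm (arcEdges a l₁ b)] at hf he'
    refine hasTheta_of_ear_left hreg hG h.swap₂₃.swap₁₂ hu (by tauto) huv hP ?_ hf heP he'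
    refine (List.Perm.nodup_iff (List.perm_iff_count.2 fun z => ?_)).1 hn
    simp only [List.count_append, List.count_cons]
    omega

/-- Any five edges of a cubic 3-connected graph lie on a common θ-graph. -/
theorem hasTheta_five (hreg : ∀ v : V, (G.neighborSet v).encard = 3) (hG : KConnected G 3)
    {e₀ e₁ e₂ e₃ e₄ : Sym2 V} (h₀ : e₀ ∈ G.edgeSet) (h₁ : e₁ ∈ G.edgeSet) (h₂ : e₂ ∈ G.edgeSet)
    (h₃ : e₃ ∈ G.edgeSet) (h₄ : e₄ ∈ G.edgeSet) : HasTheta G {e₀, e₁, e₂, e₃, e₄} := by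
  have t₀ : HasTheta G (Set.range ![e₀, e₀, e₀, e₀]) :=
    (hasTheta_singleton hreg hG h₀).mono (by simp)
  have t₁ : HasTheta G (Set.range ![e₀, e₀, e₀, e₁]) :=
    (hasTheta_insert hreg hG t₀ h₁).mono (by simp)
  have t₂ : HasTheta G (Set.range ![e₀, e₀, e₁, e₂]) :=
    (hasTheta_insert hreg hG t₁ h₂).mono (by simp)
  have t₃ : HasTheta G (Set.range ![e₀, e₁, e₂, e₃]) :=
    (hasTheta_insert hreg hG t₂ h₃).mono (by simp)
  exact (hasTheta_insert hreg hG t₃ h₄).mono (by simp [Set.insert_subset_iff])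

end

section

theorem nonempty_homeomorph_of_ker_eq {X Y Z : Type*} [TopologicalSpace X] [CompactSpace X]
    [TopologicalSpace Y] [T2Space Y] [TopologicalSpace Z] [T2Space Z] {f : X → Y} {g : X → Z}
    (hf : Continuous f) (hf' : f.Surjective) (hg : Continuous g) (hg' : g.Surjective)
    (h : ∀ x y, f x = f y ↔ g x = g y) : Nonempty (Y ≃ₜ Z) := by
  have hq : Topology.IsQuotientMap (⟨f, hf⟩ : C(X, Y)) := .of_surjective_continuous hf' hf
  have hq' : Topology.IsQuotientMap (⟨g, hg⟩ : C(X, Z)) := .of_surjective_continuous hg' hg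
  have hk : Setoid.ker (⟨f, hf⟩ : C(X, Y)) = Setoid.ker (⟨g, hg⟩ : C(X, Z)) :=
    Setoid.ext fun x y => h x y
  exact ⟨(hq.homeomorph.symm.trans (Homeomorph.Quotient.congrRight fun x y => h x y)).trans
    hq'.homeomorph⟩

variable {G : SimpleGraph V} {L L' : List V} {t t' : ℝ}

open Classical in
/-- The point of `|G|` at distance `t` from the start of the path with vertex list `L`. -/
noncomputable def pathPoint (L : List V) (t : ℝ) : V → ℝ :=
  fun u => if u ∈ L then max 0 (1 - |t - L.idxOf u|) else 0

theorem continuous_pathPoint (L : List V) : Continuous (pathPoint L) := by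
  refine continuous_pi fun u => ?_
  unfold pathPoint
  split_ifs <;> fun_prop

theorem pathPoint_of_notMem {u : V} (hu : u ∉ L) : pathPoint L t u = 0 := if_neg hu

theorem pathPoint_getElem (hL : L.Nodup) {k : ℕ} (hk : k < L.length) :
    pathPoint L t L[k] = max 0 (1 - |t - k|) := by
  classical
  rw [pathPoint, if_pos (List.getElem_mem hk)]
  congr
  exact hL.idxOf_getElem k hk

theorem pathPoint_eq_edgePoint (hL : L.Nodup) {k : ℕ} (hk : k + 1 < L.length)
    (ht : t ∈ Set.Icc (0 : ℝ) 1) : pathPoint L (k + t) = edgePoint L[k] L[k + 1] t := by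
  classical
  ext u
  by_cases hu : u ∈ L
  · obtain ⟨m, hm, rfl⟩ := List.mem_iff_getElem.1 hu
    rw [pathPoint_getElem hL hm, edgePoint]
    simp only [hL.getElem_inj_iff]
    rcases lt_trichotomy m k with h | rfl | h
    · have : (m : ℝ) + 1 ≤ k := by exact_mod_cast h
      rw [if_neg (by omega), if_neg (by omega), abs_of_nonneg (by linarith [ht.1]),
        max_eq_left (by linarith [ht.1]), add_zero]
    · rw [if_pos rfl, if_neg (by omega), add_sub_cancel_left, abs_of_nonneg ht.1,
        max_eq_right (by linarith [ht.2]), add_zero]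
    · rcases eq_or_lt_of_le (Nat.succ_le_of_lt h) with rfl | h
      · rw [if_neg (by omega), if_pos rfl, abs_of_nonpos (by push_cast; linarith [ht.2]),
          max_eq_right (by push_cast; linarith [ht.1])]
        push_cast
        ring
      · have : (k : ℝ) + 2 ≤ m := by exact_mod_cast h
        rw [if_neg (by omega), if_neg (by omega), abs_of_nonpos (by linarith [ht.2]),
          max_eq_left (by linarith [ht.2]), add_zero]
  · rw [pathPoint_of_notMem hu, edgePoint, if_neg, if_neg, add_zero]
    · rintro rfl
      exact hu (List.getElem_mem _)
    · rintro rfl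
      exact hu (List.getElem_mem _)

theorem exists_floor {n : ℕ} (ht : t ∈ Set.Icc (0 : ℝ) n) : ∃ k ≤ n, (k : ℝ) ≤ t ∧ t < k + 1 := by
  refine ⟨⌊t⌋₊, ?_, Nat.floor_le ht.1, Nat.lt_floor_add_one t⟩
  exact Nat.floor_le_of_le ht.2

theorem pathPoint_injOn (hL : L.Nodup) {n : ℕ} (hn : L.length = n + 1) :
    Set.InjOn (pathPoint L) (Set.Icc (0 : ℝ) n) := by
  intro t ht t' ht' h
  wlog htt : t ≤ t' generalizing t t'
  · exact (this ht' ht h.symm (le_of_not_ge htt)).symm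
  obtain ⟨k, hk, h₁, h₂⟩ := exists_floor ht
  have hk' : k < L.length := by omega
  have := congrFun h L[k]
  rw [pathPoint_getElem hL, pathPoint_getElem hL, abs_of_nonneg (by linarith),
    abs_of_nonneg (by linarith), max_eq_right (by linarith)] at this
  rcases max_choice 0 (1 - (t' - k)) with h' | h' <;> rw [h'] at this <;> linarith

/-- A point on the path `L` supported on the endpoints of `L` is one of these endpoints. -/
theorem eq_endpoint_of_support (hL : L.Nodup) {n : ℕ} (hn : L.length = n + 1) (hn₁ : 1 < n)
    (ht : t ∈ Set.Icc (0 : ℝ) n)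
    (h : ∀ (k : ℕ) (hk : k < L.length), pathPoint L t L[k] ≠ 0 → k = 0 ∨ k = n) :
    t = 0 ∨ t = n := by
  obtain ⟨k, hk, h₁, h₂⟩ := exists_floor ht
  have hkL : k < L.length := by omega
  have := h k hkL (by
    rw [pathPoint_getElem hL, abs_of_nonneg (by linarith), max_eq_right (by linarith)]
    linarith)
  rcases this with rfl | rfl
  · left
    by_contra h₀
    rw [Nat.cast_zero] at h₁ h₂
    have h₁ := lt_of_le_of_ne h₁ (Ne.symm h₀)
    have hL₁ : 1 < L.length := by omega
    have := h 1 hL₁ (by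
      rw [pathPoint_getElem hL, Nat.cast_one, abs_of_nonpos (by linarith),
        max_eq_right (by linarith)]
      linarith)
    omega
  · exact Or.inr (le_antisymm ht.2 h₁)

theorem edgePoint_symm (v w : V) (t : ℝ) : edgePoint v w t = edgePoint w v (1 - t) := by
  ext u
  simp only [edgePoint]
  rw [sub_sub_cancel, add_comm]

theorem exists_getElem_of_mem_listEdges {e : Sym2 V} (he : e ∈ listEdges L) :
    ∃ (k : ℕ) (hk : k + 1 < L.length), e = s(L[k], L[k + 1]) := by
  induction L with
  | nil => simp [listEdges] at he
  | cons x l ih =>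
    cases l with
    | nil => simp [listEdges] at he
    | cons y l =>
      rcases he with rfl | he
      · exact ⟨0, by simp, by simp⟩
      · obtain ⟨k, hk, rfl⟩ := ih he
        exact ⟨k + 1, by simpa using hk, by simp⟩

theorem exists_pathPoint_eq_edgePoint (hL : L.Nodup) {n : ℕ} (hn : L.length = n + 1) {v w : V}
    (he : s(v, w) ∈ listEdges L) (ht : t ∈ Set.Icc (0 : ℝ) 1) :
    ∃ t' ∈ Set.Icc (0 : ℝ) n, pathPoint L t' = edgePoint v w t := by
  obtain ⟨k, hk, he⟩ := exists_getElem_of_mem_listEdges he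
  have hkn : (k : ℝ) + 1 ≤ n := by exact_mod_cast (by omega : k + 1 ≤ n)
  have hk₀ : (0 : ℝ) ≤ k := k.cast_nonneg
  obtain ⟨ht₀, ht₁⟩ := ht
  rcases Sym2.eq_iff.1 he with ⟨rfl, rfl⟩ | ⟨rfl, rfl⟩
  · exact ⟨k + t, ⟨by linarith, by linarith⟩, pathPoint_eq_edgePoint hL hk ⟨ht₀, ht₁⟩⟩
  · refine ⟨k + (1 - t), ⟨by linarith, by linarith⟩, ?_⟩
    rw [edgePoint_symm _ _ t]
    exact pathPoint_eq_edgePoint hL hk ⟨by linarith, by linarith⟩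

theorem pathPoint_mem (hL : L.Nodup) (hG : L.IsChain G.Adj) {n : ℕ} (hn : L.length = n + 1)
    (hn₁ : 0 < n) (ht : t ∈ Set.Icc (0 : ℝ) n) : pathPoint L t ∈ GraphRealization G := by
  have key : ∀ (k : ℕ) (hk : k + 1 < L.length) (r : ℝ), r ∈ Set.Icc (0 : ℝ) 1 →
      pathPoint L (k + r) ∈ GraphRealization G := fun k hk r hr =>
    Or.inr ⟨L[k], L[k + 1], r, List.isChain_iff_getElem.1 hG k hk, hr,
      pathPoint_eq_edgePoint hL hk hr⟩
  obtain ⟨k, hk, h₁, h₂⟩ := exists_floor ht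
  rcases hk.lt_or_eq with hk | rfl
  · have := key k (by omega) (t - k) ⟨by linarith, by linarith⟩
    rwa [add_sub_cancel] at this
  · obtain rfl : t = k := le_antisymm ht.2 h₁
    obtain ⟨m, rfl⟩ := Nat.exists_eq_add_of_lt hn₁
    have := key m (by omega) 1 (by simp)
    simpa using this

end

section

variable {G : SimpleGraph V} {a b : V} {l l' l₁ l₂ l₃ L : List V}

theorem pathPoint_natCast (hL : L.Nodup) {k : ℕ} (hk : k < L.length) :
    pathPoint L k = vertexPoint L[k] := by
  classical
  ext u
  by_cases hu : u ∈ L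
  · obtain ⟨m, hm, rfl⟩ := List.mem_iff_getElem.1 hu
    rw [pathPoint_getElem hL hm, vertexPoint]
    simp only [hL.getElem_inj_iff]
    rcases lt_trichotomy m k with h | rfl | h
    · have : (m : ℝ) + 1 ≤ k := by exact_mod_cast h
      rw [if_neg (by omega), abs_of_nonneg (by linarith), max_eq_left (by linarith)]
    · simp
    · have : (k : ℝ) + 1 ≤ m := by exact_mod_cast h
      rw [if_neg (by omega), abs_of_nonpos (by linarith), max_eq_left (by linarith)]
  · rw [pathPoint_of_notMem hu, vertexPoint, if_neg]
    rintro rfl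
    exact hu (List.getElem_mem _)

/-- The arc from `a` to `b` with interior vertices `l`, parametrized by `[0, 1]`. -/
noncomputable def arcPoint (a : V) (l : List V) (b : V) (s : ℝ) : V → ℝ :=
  pathPoint (a :: (l ++ [b])) ((l.length + 1 : ℕ) * s)

theorem continuous_arcPoint (a : V) (l : List V) (b : V) : Continuous (arcPoint a l b) :=
  (continuous_pathPoint _).comp (by fun_prop)

theorem mul_mem_Icc {n : ℕ} {s : ℝ} (hs : s ∈ Set.Icc (0 : ℝ) 1) :
    n * s ∈ Set.Icc (0 : ℝ) n :=
  ⟨mul_nonneg n.cast_nonneg hs.1, mul_le_of_le_one_right n.cast_nonneg hs.2⟩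

theorem arcPoint_injOn (hl : (a :: (l ++ [b])).Nodup) :
    Set.InjOn (arcPoint a l b) (Set.Icc 0 1) := by
  intro s hs s' hs' h
  have := pathPoint_injOn hl (n := l.length + 1) (by simp) (mul_mem_Icc hs) (mul_mem_Icc hs') h
  exact mul_left_cancel₀ (by positivity) this

theorem arcPoint_zero (hl : (a :: (l ++ [b])).Nodup) : arcPoint a l b 0 = vertexPoint a := by
  have := pathPoint_natCast hl (k := 0) (by simp)
  simpa [arcPoint] using this

theorem arcPoint_one (hl : (a :: (l ++ [b])).Nodup) : arcPoint a l b 1 = vertexPoint b := by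
  have := pathPoint_natCast hl (k := l.length + 1) (by simp)
  simpa [arcPoint] using this

theorem eq_endpoint_of_arcPoint_eq (hl : (a :: (l ++ [b])).Nodup) (hd : List.Disjoint l l')
    (hne : l ≠ []) {s s' : ℝ} (hs : s ∈ Set.Icc (0 : ℝ) 1)
    (h : arcPoint a l b s = arcPoint a l' b s') : s = 0 ∨ s = 1 := by
  have hpos := List.length_pos_of_ne_nil hne
  have := eq_endpoint_of_support hl (n := l.length + 1) (by simp) (by omega)
    (mul_mem_Icc (n := l.length + 1) hs) (fun k hk hk' => by
      by_contra! hc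
      change arcPoint a l b s _ ≠ 0 at hk'
      rw [h] at hk'
      refine hk' (pathPoint_of_notMem ?_)
      obtain ⟨m, rfl⟩ := Nat.exists_eq_succ_of_ne_zero hc.1
      have hm : m < l.length := by simp at hk; omega
      have hlm : l[m] ∈ l := List.getElem_mem hm
      have h₁ := hd hlm
      simp only [List.getElem_cons_succ, List.getElem_append_left hm]
      grind)
  rcases this with h | h
  · left
    exact (mul_eq_zero.1 h).resolve_left (by positivity)
  · right
    exact mul_left_cancel₀ (by positivity : ((l.length + 1 : ℕ) : ℝ) ≠ 0) (by rw [h, mul_one])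

theorem arcPoint_eq_iff (hl : (a :: (l ++ [b])).Nodup) (hl' : (a :: (l' ++ [b])).Nodup)
    (hd : List.Disjoint l l') (hne : l ≠ [] ∨ l' ≠ []) {s s' : ℝ} (hs : s ∈ Set.Icc (0 : ℝ) 1)
    (hs' : s' ∈ Set.Icc (0 : ℝ) 1) :
    arcPoint a l b s = arcPoint a l' b s' ↔ s = s' ∧ (s = 0 ∨ s = 1) := by
  wlog hne' : l ≠ [] generalizing l l' s s'
  · rw [eq_comm, this hl' hl hd.symm hne.symm hs' hs (hne.resolve_left hne'), eq_comm]
    exact and_congr_right fun h => by rw [h]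
  refine ⟨fun h => ?_, ?_⟩
  · have h₁ := eq_endpoint_of_arcPoint_eq hl hd hne' hs h
    refine ⟨?_, h₁⟩
    rcases h₁ with rfl | rfl
    · rw [arcPoint_zero hl, ← arcPoint_zero hl'] at h
      exact arcPoint_injOn hl' hs hs' h
    · rw [arcPoint_one hl, ← arcPoint_one hl'] at h
      exact arcPoint_injOn hl' hs hs' h
  · rintro ⟨rfl, rfl | rfl⟩
    · rw [arcPoint_zero hl, arcPoint_zero hl']
    · rw [arcPoint_one hl, arcPoint_one hl']

/-- The θ-curve as a quotient of three unit intervals. -/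
noncomputable def thetaPoint (p : unitInterval × Fin 3) : ℝ × ℝ :=
  (2 * p.1 - 1, ![1, -1, 0] p.2 * √(1 - (2 * p.1 - 1) ^ 2))

theorem continuous_thetaPoint : Continuous thetaPoint := by
  rw [continuous_prod_of_discrete_right]
  intro i
  unfold thetaPoint
  fun_prop

theorem one_sub_sq_nonneg (s : unitInterval) : 0 ≤ 1 - (2 * (s : ℝ) - 1) ^ 2 := by
  nlinarith [s.2.1, s.2.2]

theorem thetaPoint_mem (p : unitInterval × Fin 3) : thetaPoint p ∈ thetaSet := by
  obtain ⟨s, i⟩ := p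
  have hs := Real.sq_sqrt (one_sub_sq_nonneg s)
  obtain ⟨s, h₀, h₁⟩ := s
  fin_cases i
  · left
    simp [thetaPoint, circleAt] at hs ⊢
    linarith
  · left
    simp [thetaPoint, circleAt] at hs ⊢
    linarith
  · right
    simp [thetaPoint, hSeg]
    constructor <;> linarith

theorem exists_thetaPoint {q : ℝ × ℝ} (hq : q ∈ thetaSet) : ∃ p, thetaPoint p = q := by
  obtain ⟨x, y⟩ := q
  simp only [thetaSet, circleAt, hSeg, Set.mem_union, Set.mem_ofPred_eq] at hq
  have hx : -1 ≤ x ∧ x ≤ 1 := by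
    rcases hq with h | h
    · exact abs_le.1 (abs_le_one_iff_mul_self_le_one.2 (by nlinarith))
    · exact h.2
  have hx' : 2 * ((x + 1) / 2) - 1 = x := by ring
  have hm : (x + 1) / 2 ∈ unitInterval := ⟨by linarith, by linarith⟩
  rcases hq with h | h
  · have hy : √(1 - x ^ 2) = |y| := by
      rw [← Real.sqrt_sq_eq_abs]
      congr 1
      linarith
    rcases le_total 0 y with h₀ | h₀
    · refine ⟨(⟨_, hm⟩, 0), ?_⟩
      simp [thetaPoint, hx', hy, abs_of_nonneg h₀]
    · refine ⟨(⟨_, hm⟩, 1), ?_⟩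
      simp [thetaPoint, hx', hy, abs_of_nonpos h₀]
  · refine ⟨(⟨_, hm⟩, 2), ?_⟩
    simp [thetaPoint, hx', h.1]

theorem thetaPoint_eq_iff (s s' : unitInterval) (i j : Fin 3) :
    thetaPoint (s, i) = thetaPoint (s', j) ↔ s = s' ∧ (i = j ∨ s = 0 ∨ s = 1) := by
  have h₁ : thetaPoint (s, i) = thetaPoint (s', j) ↔ s = s' ∧
      ((![1, -1, 0] i : ℝ) = ![1, -1, 0] j ∨ √(1 - (2 * (s : ℝ) - 1) ^ 2) = 0) := by
    simp only [thetaPoint, Prod.mk.injEq]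
    constructor
    · rintro ⟨h, h'⟩
      obtain rfl : s = s' := Subtype.ext (by linarith)
      exact ⟨rfl, mul_eq_mul_right_iff.1 h'⟩
    · rintro ⟨rfl, h⟩
      exact ⟨rfl, mul_eq_mul_right_iff.2 h⟩
  rw [h₁]
  refine and_congr_right fun _ => or_congr ?_ ?_
  · refine ⟨fun h => ?_, fun h => by rw [h]⟩
    fin_cases i <;> fin_cases j <;> first | rfl | (norm_num at h)
  · rw [Real.sqrt_eq_zero (one_sub_sq_nonneg s), Subtype.ext_iff, Subtype.ext_iff,
      Set.Icc.coe_zero, Set.Icc.coe_one, ← sub_eq_zero (b := (1 : ℝ)), ← mul_eq_zero]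
    constructor <;> intro h <;> linarith

/-- The realization of a θ-graph is a θ-curve. -/
theorem IsTheta.exists_homeomorph (h : IsTheta G a b l₁ l₂ l₃) :
    ∃ S : Set ↥(GraphRealization G), Nonempty (↥S ≃ₜ ↥thetaSet) ∧
      ∀ (x : ↥(GraphRealization G)) (v w : V) (t : ℝ),
        s(v, w) ∈ arcEdges a l₁ b ∪ arcEdges a l₂ b ∪ arcEdges a l₃ b → t ∈ Set.Icc (0 : ℝ) 1 →
        (x : V → ℝ) = edgePoint v w t → x ∈ S := by
  have hn := h.nodup
  obtain ⟨l, hl, hadj, hd, hne, hmem⟩ : ∃ l : Fin 3 → List V,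
      (∀ i, (a :: (l i ++ [b])).Nodup) ∧ (∀ i, Arc G a (l i) b) ∧
      (∀ i j, i ≠ j → List.Disjoint (l i) (l j)) ∧ (∀ i j, i ≠ j → l i ≠ [] ∨ l j ≠ []) ∧
      ∀ e ∈ arcEdges a l₁ b ∪ arcEdges a l₂ b ∪ arcEdges a l₃ b, ∃ i, e ∈ arcEdges a (l i) b := by
    refine ⟨![l₁, l₂, l₃], ?_, ?_, ?_, ?_, ?_⟩
    · have (l : List V) (hl : List.Sublist (a :: b :: l) (a :: b :: (l₁ ++ l₂ ++ l₃))) :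
          (a :: (l ++ [b])).Nodup := by
        have := hn.sublist hl
        grind
      simp only [Fin.forall_fin_succ, Matrix.cons_val_zero, Matrix.cons_val_succ]
      refine ⟨this _ (by grind), this _ (by grind), this _ (by grind), by simp⟩
    · simp [Fin.forall_fin_succ, h.arc₁, h.arc₂, h.arc₃]
    · have h₁₂ : List.Disjoint l₁ l₂ := by intro x; grind
      have h₁₃ : List.Disjoint l₁ l₃ := by intro x; grind
      have h₂₃ : List.Disjoint l₂ l₃ := by intro x; grind
      simp [Fin.forall_fin_succ, h₁₂, h₁₃, h₂₃, h₁₂.symm, h₁₃.symm, h₂₃.symm]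
    · have := h.ne₁₂
      have := h.ne₁₃
      have := h.ne₂₃
      intro i j
      fin_cases i <;> fin_cases j <;> simp <;> tauto
    · simp [Fin.exists_fin_succ, or_assoc]
  have hmem' (p : unitInterval × Fin 3) :
      arcPoint a (l p.2) b p.1 ∈ GraphRealization G :=
    pathPoint_mem (n := (l p.2).length + 1) (hl _) (hadj _) (by simp) (by omega) (mul_mem_Icc p.1.2)
  let g : unitInterval × Fin 3 → ↥(GraphRealization G) := fun p => ⟨_, hmem' p⟩
  have hg : Continuous g := by
    rw [continuous_prod_of_discrete_right]
    exact fun i => ((continuous_arcPoint a (l i) b).comp continuous_subtype_val).subtype_mk _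
  refine ⟨Set.range g, ?_, ?_⟩
  · refine nonempty_homeomorph_of_ker_eq (f := Set.rangeFactorization g)
      (g := Set.codRestrict thetaPoint thetaSet thetaPoint_mem) hg.rangeFactorization
      Set.rangeFactorization_surjective (continuous_thetaPoint.codRestrict _) ?_ ?_
    · rintro ⟨q, hq⟩
      obtain ⟨p, rfl⟩ := exists_thetaPoint hq
      exact ⟨p, rfl⟩
    · rintro ⟨s, i⟩ ⟨s', j⟩
      rw [Subtype.ext_iff, Subtype.ext_iff, Subtype.ext_iff]
      change arcPoint a (l i) b s = arcPoint a (l j) b s' ↔ thetaPoint (s, i) = thetaPoint (s', j)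
      rw [thetaPoint_eq_iff]
      by_cases hij : i = j
      · subst hij
        simp only [true_or, and_true]
        exact ⟨fun h => Subtype.ext (arcPoint_injOn (hl i) s.2 s'.2 h), fun h => by rw [h]⟩
      · rw [arcPoint_eq_iff (hl i) (hl j) (hd i j hij) (hne i j hij) s.2 s'.2]
        simp only [hij, false_or]
        rw [Subtype.ext_iff, Subtype.ext_iff, Subtype.ext_iff, Set.Icc.coe_zero, Set.Icc.coe_one]
  · intro x v w t he ht hx
    obtain ⟨i, hi⟩ := hmem _ he
    obtain ⟨t', ht', h'⟩ := exists_pathPoint_eq_edgePoint (hl i) (n := (l i).length + 1)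
      (by simp) hi ht
    have hpos : (0 : ℝ) < ((l i).length + 1 : ℕ) := by positivity
    refine ⟨(⟨t' / ((l i).length + 1 : ℕ), div_nonneg ht'.1 hpos.le,
      (div_le_one hpos).2 ht'.2⟩, i), Subtype.ext ?_⟩
    rw [hx, ← h']
    change pathPoint _ _ = _
    rw [mul_div_cancel₀ _ hpos.ne']

/-- Every point of the realization of a graph without isolated vertices lies on an edge. -/
theorem exists_edge_of_mem (hG : ∀ v, ∃ w, G.Adj v w) {x : V → ℝ} (hx : x ∈ GraphRealization G) :
    ∃ v w t, G.Adj v w ∧ t ∈ Set.Icc (0 : ℝ) 1 ∧ x = edgePoint v w t := by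
  rcases hx with ⟨v, rfl⟩ | hx
  · obtain ⟨w, hw⟩ := hG v
    refine ⟨v, w, 0, hw, by simp, ?_⟩
    ext u
    simp [vertexPoint, edgePoint]
  · exact hx

end

end CubicGraph

/-- Any five points of the realization of a 3-regular, 3-connected graph
lie on a subspace homeomorphic to a circle or to a θ-curve. -/
theorem statement16 {V : Type*} (G : SimpleGraph V)
    (hreg : ∀ v : V, (G.neighborSet v).encard = 3)
    (hconn : KConnected G 3)
    (x₀ x₁ x₂ x₃ x₄ : ↥(GraphRealization G)) :
    ∃ S : Set ↥(GraphRealization G), x₀ ∈ S ∧ x₁ ∈ S ∧ x₂ ∈ S ∧ x₃ ∈ S ∧ x₄ ∈ S ∧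
      (Nonempty (↥S ≃ₜ ↥unitCircleSet) ∨ Nonempty (↥S ≃ₜ ↥thetaSet)) := by
  have hadj (v : V) : ∃ w, G.Adj v w := by
    obtain ⟨w, hw⟩ := Set.nonempty_of_encard_ne_zero (s := G.neighborSet v) (by simp [hreg v])
    exact ⟨w, hw⟩
  obtain ⟨v₀, w₀, t₀, a₀, m₀, e₀⟩ := CubicGraph.exists_edge_of_mem hadj x₀.2
  obtain ⟨v₁, w₁, t₁, a₁, m₁, e₁⟩ := CubicGraph.exists_edge_of_mem hadj x₁.2
  obtain ⟨v₂, w₂, t₂, a₂, m₂, e₂⟩ := CubicGraph.exists_edge_of_mem hadj x₂.2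
  obtain ⟨v₃, w₃, t₃, a₃, m₃, e₃⟩ := CubicGraph.exists_edge_of_mem hadj x₃.2
  obtain ⟨v₄, w₄, t₄, a₄, m₄, e₄⟩ := CubicGraph.exists_edge_of_mem hadj x₄.2
  obtain ⟨a, b, l₁, l₂, l₃, h, hF⟩ := CubicGraph.hasTheta_five hreg hconn
    (G.mem_edgeSet.2 a₀) (G.mem_edgeSet.2 a₁) (G.mem_edgeSet.2 a₂) (G.mem_edgeSet.2 a₃)
    (G.mem_edgeSet.2 a₄)
  obtain ⟨S, hS, hS'⟩ := h.exists_homeomorph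
  exact ⟨S, hS' x₀ v₀ w₀ t₀ (hF (by simp)) m₀ e₀, hS' x₁ v₁ w₁ t₁ (hF (by simp)) m₁ e₁,
    hS' x₂ v₂ w₂ t₂ (hF (by simp)) m₂ e₂, hS' x₃ v₃ w₃ t₃ (hF (by simp)) m₃ e₃,
    hS' x₄ v₄ w₄ t₄ (hF (by simp)) m₄ e₄, Or.inr hS⟩
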